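/- If H1 is a left Σ-galaxy and H2 is a left triangular galaxy, then there exists ε > 0 such that every {H1,H2}-free tournament T contains a transitive subtournament of size at least |T|^ε. -/

import Mathlib

open Finset

/-- A tournament on vertex set `Fin n`: `adj u v` means there is an arc from `u` to `v`. -/
structure Tournament (n : ℕ) where
  adj : Fin n → Fin n → Prop
  asymm : ∀ u v, adj u v → ¬ adj v u
  total : ∀ u v, u ≠ v → adj u v ∨ adj v u

namespace Tournament

variable {n N : ℕ}

/-- The position of vertex `v` in the ordering `θ`, where `θ k` is the `k`-th vertex. -/
def pos (θ : Equiv.Perm (Fin n)) (v : Fin n) : Fin n := θ.symm v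

/-- The arc `u → v` of `T` is a backward arc under the ordering `θ`. -/
def Backward (T : Tournament n) (θ : Equiv.Perm (Fin n)) (u v : Fin n) : Prop :=
  T.adj u v ∧ pos θ v < pos θ u

/-- `x` lies strictly between two elements of `L` under the ordering `θ`. -/
def BetweenSet (θ : Equiv.Perm (Fin n)) (L : Finset (Fin n)) (x : Fin n) : Prop :=
  ∃ u ∈ L, ∃ w ∈ L, pos θ u < pos θ x ∧ pos θ x < pos θ w

/-- The induced subtournament of `T` on `s` is transitive. -/
def IsTransOn (T : Tournament n) (s : Finset (Fin n)) : Prop :=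
  ∀ u ∈ s, ∀ v ∈ s, ∀ w ∈ s, T.adj u v → T.adj v w → T.adj u w

/-- The largest size of a transitive subtournament of `T` contained in `s`. -/
noncomputable def trSizeOn (T : Tournament n) (s : Finset (Fin n)) : ℕ :=
  sSup {k | ∃ t, t ⊆ s ∧ T.IsTransOn t ∧ t.card = k}

/-- `tr(T)`: the largest size of a transitive subtournament of `T`. -/
noncomputable def trSize (T : Tournament n) : ℕ := T.trSizeOn Finset.univ

/-- `T` contains `H`: some induced subtournament of `T` is isomorphic to `H`. -/
def Contains (T : Tournament N) (H : Tournament n) : Prop :=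
  ∃ f : Fin n ↪ Fin N, ∀ u v, H.adj u v ↔ T.adj (f u) (f v)

/-- `T` is `ε`-critical. -/
def EpsCritical (T : Tournament n) (ε : ℝ) : Prop :=
  ((T.trSize : ℝ) < (n : ℝ) ^ ε) ∧
  ∀ s : Finset (Fin n), s ≠ Finset.univ → ((s.card : ℝ) ^ ε ≤ (T.trSizeOn s : ℝ))

/-- `S` with center `c` is a right star of `T` under `θ`. -/
def IsRightStarAt (T : Tournament n) (θ : Equiv.Perm (Fin n)) (S : Finset (Fin n))
    (c : Fin n) : Prop :=
  c ∈ S ∧ (S.erase c).Nonempty ∧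
  (∀ v ∈ S.erase c, pos θ v < pos θ c ∧ T.adj c v) ∧
  (∀ u ∈ S, ∀ v ∈ S, T.Backward θ u v → u = c)

/-- `S` with center `c` is a left star of `T` under `θ`. -/
def IsLeftStarAt (T : Tournament n) (θ : Equiv.Perm (Fin n)) (S : Finset (Fin n))
    (c : Fin n) : Prop :=
  c ∈ S ∧ (S.erase c).Nonempty ∧
  (∀ v ∈ S.erase c, pos θ c < pos θ v ∧ T.adj v c) ∧
  (∀ u ∈ S, ∀ v ∈ S, T.Backward θ u v → v = c)

/-- `S` with center `c` is a middle star of `T` under `θ`. -/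
def IsMiddleStarAt (T : Tournament n) (θ : Equiv.Perm (Fin n)) (S : Finset (Fin n))
    (c : Fin n) : Prop :=
  c ∈ S ∧
  (∃ v ∈ S.erase c, pos θ v < pos θ c) ∧ (∃ v ∈ S.erase c, pos θ c < pos θ v) ∧
  (∀ v ∈ S.erase c, (pos θ v < pos θ c → T.adj c v) ∧ (pos θ c < pos θ v → T.adj v c)) ∧
  (∀ u ∈ S, ∀ v ∈ S, T.Backward θ u v → u = c ∨ v = c)

def IsFrontierStarAt (T : Tournament n) (θ : Equiv.Perm (Fin n)) (S : Finset (Fin n))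
    (c : Fin n) : Prop :=
  T.IsLeftStarAt θ S c ∨ T.IsRightStarAt θ S c

def IsStarAt (T : Tournament n) (θ : Equiv.Perm (Fin n)) (S : Finset (Fin n))
    (c : Fin n) : Prop :=
  T.IsLeftStarAt θ S c ∨ T.IsRightStarAt θ S c ∨ T.IsMiddleStarAt θ S c

/-- A middle star with exactly one leaf after the center (center is `u_{p-1}`). -/
def IsOneRightMiddleStarAt (T : Tournament n) (θ : Equiv.Perm (Fin n)) (S : Finset (Fin n))
    (c : Fin n) : Prop :=
  T.IsMiddleStarAt θ S c ∧ ((S.erase c).filter (fun v => pos θ c < pos θ v)).card = 1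

/-- A middle star with exactly one leaf before the center (center is `u_2`). -/
def IsOneLeftMiddleStarAt (T : Tournament n) (θ : Equiv.Perm (Fin n)) (S : Finset (Fin n))
    (c : Fin n) : Prop :=
  T.IsMiddleStarAt θ S c ∧ ((S.erase c).filter (fun v => pos θ v < pos θ c)).card = 1

/-- Kinds of super 2-nebulas. -/
inductive NebKind
  | left
  | middle
  | right

/-- Common requirements on the data of a super 2-nebula: vertex set `S`, centers `c₁, c₂`
(`c₁` before `c₂` under `θ`), leaves `L₁` incident to `c₁` and `L₂` incident to `c₂`. -/
def Super2NebCommon (θ : Equiv.Perm (Fin n)) (S : Finset (Fin n)) (c₁ c₂ : Fin n)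
    (L₁ L₂ : Finset (Fin n)) : Prop :=
  L₁.Nonempty ∧ L₂.Nonempty ∧ Disjoint L₁ L₂ ∧
  c₁ ∉ L₁ ∪ L₂ ∧ c₂ ∉ L₁ ∪ L₂ ∧ c₁ ≠ c₂ ∧
  S = insert c₁ (insert c₂ (L₁ ∪ L₂)) ∧ pos θ c₁ < pos θ c₂

/-- `S` is a super (left/middle/right) 2-nebula of `T` under `θ`, with centers `c₁, c₂` and
leaves `L₁` (incident to `c₁`) and `L₂` (incident to `c₂`). -/
def IsSuper2NebulaAt (T : Tournament n) (θ : Equiv.Perm (Fin n)) (S : Finset (Fin n))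
    (c₁ c₂ : Fin n) (L₁ L₂ : Finset (Fin n)) : NebKind → Prop
  | NebKind.middle =>
      Super2NebCommon θ S c₁ c₂ L₁ L₂ ∧
      (∀ v ∈ L₁ ∪ L₂, pos θ c₁ < pos θ v ∧ pos θ v < pos θ c₂) ∧
      (∀ v ∈ L₁, T.adj v c₁) ∧ (∀ v ∈ L₂, T.adj c₂ v) ∧ T.adj c₂ c₁ ∧
      (∀ u ∈ S, ∀ v ∈ S, T.Backward θ u v →
        (u ∈ L₁ ∧ v = c₁) ∨ (u = c₂ ∧ v ∈ L₂) ∨ (u = c₂ ∧ v = c₁))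
  | NebKind.left =>
      Super2NebCommon θ S c₁ c₂ L₁ L₂ ∧
      (∀ v ∈ L₁ ∪ L₂, pos θ v < pos θ c₁) ∧
      (∀ v ∈ L₁, T.adj c₁ v) ∧ (∀ v ∈ L₂, T.adj c₂ v) ∧ T.adj c₂ c₁ ∧
      (∀ u ∈ S, ∀ v ∈ S, T.Backward θ u v →
        (u = c₁ ∧ v ∈ L₁) ∨ (u = c₂ ∧ v ∈ L₂) ∨ (u = c₂ ∧ v = c₁))
  | NebKind.right =>
      Super2NebCommon θ S c₁ c₂ L₁ L₂ ∧
      (∀ v ∈ L₁ ∪ L₂, pos θ c₂ < pos θ v) ∧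
      (∀ v ∈ L₁, T.adj v c₁) ∧ (∀ v ∈ L₂, T.adj v c₂) ∧ T.adj c₂ c₁ ∧
      (∀ u ∈ S, ∀ v ∈ S, T.Backward θ u v →
        (u ∈ L₁ ∧ v = c₁) ∨ (u ∈ L₂ ∧ v = c₂) ∨ (u = c₂ ∧ v = c₁))

/-- A decomposition of `T` witnessing that `T` is a super nebula under `θ`, with stars
`Q i` (centers `ctr i`) and super 2-nebulas `Sig i` (centers `c₁ i, c₂ i`, leaves
`L₁ i, L₂ i`, of kind `kd i`). -/
def SuperNebulaDecomp (T : Tournament n) (θ : Equiv.Perm (Fin n)) {m l : ℕ}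
    (Q : Fin m → Finset (Fin n)) (ctr : Fin m → Fin n)
    (Sig : Fin l → Finset (Fin n)) (c₁ c₂ : Fin l → Fin n)
    (L₁ L₂ : Fin l → Finset (Fin n)) (kd : Fin l → NebKind) : Prop :=
  (∀ i, T.IsStarAt θ (Q i) (ctr i)) ∧
  (∀ i, T.IsSuper2NebulaAt θ (Sig i) (c₁ i) (c₂ i) (L₁ i) (L₂ i) (kd i)) ∧
  (∀ i j, i ≠ j → Disjoint (Q i) (Q j)) ∧
  (∀ i j, i ≠ j → Disjoint (Sig i) (Sig j)) ∧
  (∀ i j, Disjoint (Q i) (Sig j)) ∧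
  (∀ u v, T.Backward θ u v → (∃ i, u ∈ Q i ∧ v ∈ Q i) ∨ (∃ i, u ∈ Sig i ∧ v ∈ Sig i)) ∧
  (∀ i j, ¬ BetweenSet θ (L₁ j ∪ L₂ j) (ctr i)) ∧
  (∀ i j, i ≠ j → ¬ BetweenSet θ (L₁ j ∪ L₂ j) (c₁ i) ∧ ¬ BetweenSet θ (L₁ j ∪ L₂ j) (c₂ i))

/-- `T` is a super nebula. -/
def IsSuperNebula (T : Tournament n) : Prop :=
  ∃ (θ : Equiv.Perm (Fin n)) (m l : ℕ) (Q : Fin m → Finset (Fin n)) (ctr : Fin m → Fin n)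
    (Sig : Fin l → Finset (Fin n)) (c₁ c₂ : Fin l → Fin n)
    (L₁ L₂ : Fin l → Finset (Fin n)) (kd : Fin l → NebKind),
    SuperNebulaDecomp T θ Q ctr Sig c₁ c₂ L₁ L₂ kd

/-- `{a, b, c}` (in this position order) is a triangle of `T` under `θ`:
`a` is the left exterior, `b` the center, `c` the right exterior. -/
def IsTriangleAt (T : Tournament n) (θ : Equiv.Perm (Fin n)) (a b c : Fin n) : Prop :=
  pos θ a < pos θ b ∧ pos θ b < pos θ c ∧ T.adj b a ∧ T.adj c a ∧ T.adj c b

/-- A decomposition of `T` under `θ` into triangles `{A i, B i, C i}` (left exterior, center,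
right exterior) and frontier stars `Q j` with centers `ctr j`, where for each triangle `i`,
the vertices in `forb i` are not allowed to lie between leaves of a star. -/
def TriGalaxyDecomp (T : Tournament n) (θ : Equiv.Perm (Fin n)) {l k : ℕ}
    (A B C : Fin l → Fin n) (Q : Fin k → Finset (Fin n)) (ctr : Fin k → Fin n)
    (forb : Fin l → Finset (Fin n)) : Prop :=
  (∀ i, T.IsTriangleAt θ (A i) (B i) (C i)) ∧
  (∀ j, T.IsFrontierStarAt θ (Q j) (ctr j)) ∧
  (∀ i j, i ≠ j →
    Disjoint ({A i, B i, C i} : Finset (Fin n)) ({A j, B j, C j} : Finset (Fin n))) ∧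
  (∀ i j, Disjoint ({A i, B i, C i} : Finset (Fin n)) (Q j)) ∧
  (∀ i j, i ≠ j → Disjoint (Q i) (Q j)) ∧
  (∀ u v, T.Backward θ u v →
    (∃ i, u ∈ ({A i, B i, C i} : Finset (Fin n)) ∧ v ∈ ({A i, B i, C i} : Finset (Fin n))) ∨
    (∃ j, u ∈ Q j ∧ v ∈ Q j)) ∧
  (∀ i j, i ≠ j → ¬ BetweenSet θ ((Q j).erase (ctr j)) (ctr i)) ∧
  (∀ i j, ∀ x ∈ forb i, ¬ BetweenSet θ ((Q j).erase (ctr j)) x)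

/-- `T` is a Δgalaxy: a triangular galaxy with exactly one triangle. -/
def IsDeltaGalaxy (T : Tournament n) : Prop :=
  ∃ (θ : Equiv.Perm (Fin n)) (a b c : Fin n) (k : ℕ)
    (Q : Fin k → Finset (Fin n)) (ctr : Fin k → Fin n),
    TriGalaxyDecomp T θ (fun _ : Fin 1 => a) (fun _ => b) (fun _ => c) Q ctr
      (fun _ => ({a, b, c} : Finset (Fin n)))

/-- `T` is a central triangular galaxy: centers of triangles may lie between leaves of stars. -/
def IsCentralTriangularGalaxy (T : Tournament n) : Prop :=
  ∃ (θ : Equiv.Perm (Fin n)) (l k : ℕ) (A B C : Fin l → Fin n)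
    (Q : Fin k → Finset (Fin n)) (ctr : Fin k → Fin n),
    TriGalaxyDecomp T θ A B C Q ctr (fun i => ({A i, C i} : Finset (Fin n)))

/-- `T` is a left triangular galaxy: left exteriors of triangles may lie between leaves. -/
def IsLeftTriangularGalaxy (T : Tournament n) : Prop :=
  ∃ (θ : Equiv.Perm (Fin n)) (l k : ℕ) (A B C : Fin l → Fin n)
    (Q : Fin k → Finset (Fin n)) (ctr : Fin k → Fin n),
    TriGalaxyDecomp T θ A B C Q ctr (fun i => ({B i, C i} : Finset (Fin n)))

/-- `T` is a right triangular galaxy: right exteriors of triangles may lie between leaves. -/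
def IsRightTriangularGalaxy (T : Tournament n) : Prop :=
  ∃ (θ : Equiv.Perm (Fin n)) (l k : ℕ) (A B C : Fin l → Fin n)
    (Q : Fin k → Finset (Fin n)) (ctr : Fin k → Fin n),
    TriGalaxyDecomp T θ A B C Q ctr (fun i => ({A i, B i} : Finset (Fin n)))

/-- A decomposition of `T` witnessing that `T` is a nebula under `θ` (no condition on the
location of the centers of the stars). -/
def NebulaDecomp (T : Tournament n) (θ : Equiv.Perm (Fin n)) {k : ℕ}
    (Q : Fin k → Finset (Fin n)) (ctr : Fin k → Fin n) : Prop :=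
  (∀ i, T.IsStarAt θ (Q i) (ctr i)) ∧
  (∀ i j, i ≠ j → Disjoint (Q i) (Q j)) ∧
  (∀ u v, T.Backward θ u v → ∃ i, u ∈ Q i ∧ v ∈ Q i)

/-- `T` is a central nebula: a nebula all of whose stars are 3-vertex middle stars. -/
def IsCentralNebula (T : Tournament n) : Prop :=
  ∃ (θ : Equiv.Perm (Fin n)) (k : ℕ) (Q : Fin k → Finset (Fin n)) (ctr : Fin k → Fin n),
    NebulaDecomp T θ Q ctr ∧ ∀ i, T.IsMiddleStarAt θ (Q i) (ctr i) ∧ (Q i).card = 3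

/-- `T` is a super left nebula: a nebula all of whose stars are left stars. -/
def IsSuperLeftNebula (T : Tournament n) : Prop :=
  ∃ (θ : Equiv.Perm (Fin n)) (k : ℕ) (Q : Fin k → Finset (Fin n)) (ctr : Fin k → Fin n),
    NebulaDecomp T θ Q ctr ∧ ∀ i, T.IsLeftStarAt θ (Q i) (ctr i)

/-- `T` is a super right nebula: a nebula all of whose stars are right stars. -/
def IsSuperRightNebula (T : Tournament n) : Prop :=
  ∃ (θ : Equiv.Perm (Fin n)) (k : ℕ) (Q : Fin k → Finset (Fin n)) (ctr : Fin k → Fin n),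
    NebulaDecomp T θ Q ctr ∧ ∀ i, T.IsRightStarAt θ (Q i) (ctr i)

/-- `T` is an LR-Δgalaxy: a super Δgalaxy in which only the two exteriors of the triangle
may lie between leaves of a star. -/
def IsLRDeltaGalaxy (T : Tournament n) : Prop :=
  ∃ (θ : Equiv.Perm (Fin n)) (a b c : Fin n) (k : ℕ)
    (Q : Fin k → Finset (Fin n)) (ctr : Fin k → Fin n),
    TriGalaxyDecomp T θ (fun _ : Fin 1 => a) (fun _ => b) (fun _ => c) Q ctr
      (fun _ => ({b} : Finset (Fin n)))

/-- `T` is a CR-Δgalaxy. -/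
def IsCRDeltaGalaxy (T : Tournament n) : Prop :=
  ∃ (θ : Equiv.Perm (Fin n)) (a b c : Fin n) (k : ℕ)
    (Q : Fin k → Finset (Fin n)) (ctr : Fin k → Fin n),
    TriGalaxyDecomp T θ (fun _ : Fin 1 => a) (fun _ => b) (fun _ => c) Q ctr
      (fun _ => ({a} : Finset (Fin n))) ∧
    (∀ i j, i ≠ j → BetweenSet θ ((Q i).erase (ctr i)) b →
      BetweenSet θ ((Q j).erase (ctr j)) c →
      (∀ x ∈ (Q i).erase (ctr i), ¬ BetweenSet θ ((Q j).erase (ctr j)) x) ∧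
      (∀ x ∈ (Q j).erase (ctr j), ¬ BetweenSet θ ((Q i).erase (ctr i)) x)) ∧
    (∀ i, BetweenSet θ ((Q i).erase (ctr i)) b → ¬ BetweenSet θ ((Q i).erase (ctr i)) c)

/-- `T` is a CL-Δgalaxy. -/
def IsCLDeltaGalaxy (T : Tournament n) : Prop :=
  ∃ (θ : Equiv.Perm (Fin n)) (a b c : Fin n) (k : ℕ)
    (Q : Fin k → Finset (Fin n)) (ctr : Fin k → Fin n),
    TriGalaxyDecomp T θ (fun _ : Fin 1 => a) (fun _ => b) (fun _ => c) Q ctr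
      (fun _ => ({c} : Finset (Fin n))) ∧
    (∀ i j, i ≠ j → BetweenSet θ ((Q i).erase (ctr i)) b →
      BetweenSet θ ((Q j).erase (ctr j)) a →
      (∀ x ∈ (Q i).erase (ctr i), ¬ BetweenSet θ ((Q j).erase (ctr j)) x) ∧
      (∀ x ∈ (Q j).erase (ctr j), ¬ BetweenSet θ ((Q i).erase (ctr i)) x)) ∧
    (∀ i, BetweenSet θ ((Q i).erase (ctr i)) b → ¬ BetweenSet θ ((Q i).erase (ctr i)) a)

/-- A decomposition of `T` under `θ` into one super 2-nebula (of kind `kd`) and frontier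
stars, covering all of `V(T)`, witnessing that `T` is a Σ-galaxy under `θ`. -/
def SigmaGalaxyDecomp (T : Tournament n) (θ : Equiv.Perm (Fin n))
    (S : Finset (Fin n)) (c₁ c₂ : Fin n) (L₁ L₂ : Finset (Fin n)) (kd : NebKind)
    {m : ℕ} (Q : Fin m → Finset (Fin n)) (ctr : Fin m → Fin n) : Prop :=
  T.IsSuper2NebulaAt θ S c₁ c₂ L₁ L₂ kd ∧
  (∀ j, T.IsFrontierStarAt θ (Q j) (ctr j)) ∧
  (∀ i j, i ≠ j → Disjoint (Q i) (Q j)) ∧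
  (∀ j, Disjoint S (Q j)) ∧
  (∀ v, v ∈ S ∨ ∃ j, v ∈ Q j) ∧
  (∀ u v, T.Backward θ u v → (u ∈ S ∧ v ∈ S) ∨ ∃ j, u ∈ Q j ∧ v ∈ Q j) ∧
  (∀ j, ¬ BetweenSet θ (L₁ ∪ L₂) (ctr j)) ∧
  (∀ j, ¬ BetweenSet θ ((Q j).erase (ctr j)) c₁ ∧ ¬ BetweenSet θ ((Q j).erase (ctr j)) c₂) ∧
  (∀ i j, i ≠ j → ¬ BetweenSet θ ((Q j).erase (ctr j)) (ctr i))

def IsMiddleSigmaGalaxy (T : Tournament n) : Prop :=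
  ∃ (θ : Equiv.Perm (Fin n)) (S : Finset (Fin n)) (c₁ c₂ : Fin n) (L₁ L₂ : Finset (Fin n))
    (m : ℕ) (Q : Fin m → Finset (Fin n)) (ctr : Fin m → Fin n),
    SigmaGalaxyDecomp T θ S c₁ c₂ L₁ L₂ NebKind.middle Q ctr

def IsLeftSigmaGalaxy (T : Tournament n) : Prop :=
  ∃ (θ : Equiv.Perm (Fin n)) (S : Finset (Fin n)) (c₁ c₂ : Fin n) (L₁ L₂ : Finset (Fin n))
    (m : ℕ) (Q : Fin m → Finset (Fin n)) (ctr : Fin m → Fin n),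
    SigmaGalaxyDecomp T θ S c₁ c₂ L₁ L₂ NebKind.left Q ctr

def IsRightSigmaGalaxy (T : Tournament n) : Prop :=
  ∃ (θ : Equiv.Perm (Fin n)) (S : Finset (Fin n)) (c₁ c₂ : Fin n) (L₁ L₂ : Finset (Fin n))
    (m : ℕ) (Q : Fin m → Finset (Fin n)) (ctr : Fin m → Fin n),
    SigmaGalaxyDecomp T θ S c₁ c₂ L₁ L₂ NebKind.right Q ctr

/-- The directed density from `X` to `Y`. -/
noncomputable def density (T : Tournament n) (X Y : Finset (Fin n)) : ℝ :=
  (Set.ncard {p : Fin n × Fin n | p.1 ∈ X ∧ p.2 ∈ Y ∧ T.adj p.1 p.2} : ℝ) /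
    ((X.card : ℝ) * (Y.card : ℝ))

/-- `(S i)` is a smooth `(c, lam, w)`-structure of `T`. -/
def IsSmoothStructure (T : Tournament n) (c lam : ℝ) {N : ℕ} (w : Fin N → Bool)
    (S : Fin N → Finset (Fin n)) : Prop :=
  (∀ i j, i ≠ j → Disjoint (S i) (S j)) ∧
  (∀ i, w i = false → c * (n : ℝ) ≤ ((S i).card : ℝ)) ∧
  (∀ i, w i = true → T.IsTransOn (S i) ∧ c * (T.trSize : ℝ) ≤ ((S i).card : ℝ)) ∧
  (∀ i j, i < j →
    (∀ v ∈ S i, 1 - lam ≤ T.density {v} (S j)) ∧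
    (∀ v ∈ S j, 1 - lam ≤ T.density (S i) {v}))

end Tournament

/-- The backward arcs of `K₆` under its canonical ordering. -/
def K6back : List (ℕ × ℕ) := [(3, 0), (5, 2), (5, 0), (4, 1)]

/-- The tournament `K₆`, on `Fin 6` with its canonical ordering. -/
def K6 : Tournament 6 where
  adj u v := (u.val, v.val) ∈ K6back ∨ (u < v ∧ (v.val, u.val) ∉ K6back)
  asymm := by decide
  total := by decide

/-- The pair `{H₁, H₂}` satisfies the Erdős–Hajnal conjecture: there is `ε > 0` such that
every `{H₁, H₂}`-free tournament `T` has a transitive subtournament of size `≥ |T| ^ ε`. -/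
def EHPair {n₁ n₂ : ℕ} (H₁ : Tournament n₁) (H₂ : Tournament n₂) : Prop :=
  ∃ ε : ℝ, 0 < ε ∧ ∀ (n : ℕ) (T : Tournament n),
    ¬ T.Contains H₁ → ¬ T.Contains H₂ → (n : ℝ) ^ ε ≤ (T.trSize : ℝ)

open Tournament

namespace TournamentEH
open scoped Classical

section Sparsity

variable {n : ℕ} {T : Tournament n}

theorem adj_irrefl (T : Tournament n) (x : Fin n) : ¬ T.adj x x := fun h => T.asymm x x h h

theorem adj_of_not_adj {x y : Fin n} (hne : x ≠ y) (h : ¬ T.adj x y) : T.adj y x :=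
  (T.total x y hne).resolve_left h

/-- The number of vertices of `W` that `x` does not dominate. -/
noncomputable def missOut (T : Tournament n) (x : Fin n) (W : Finset (Fin n)) : ℕ :=
  (W.filter fun y => ¬ T.adj x y).card

/-- The number of vertices of `U` that do not dominate `y`. -/
noncomputable def missIn (T : Tournament n) (y : Fin n) (U : Finset (Fin n)) : ℕ :=
  (U.filter fun x => ¬ T.adj x y).card

/-- All but a proportion `lam` of the pairs of `U × W` are arcs from `U` to `W`. -/
def Sparse (T : Tournament n) (lam : ℝ) (U W : Finset (Fin n)) : Prop :=
  ∑ x ∈ U, (missOut T x W : ℝ) ≤ lam * U.card * W.card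

/-- The vertexwise strengthening of `Sparse`. -/
def Smooth (T : Tournament n) (lam : ℝ) (U W : Finset (Fin n)) : Prop :=
  (∀ x ∈ U, (missOut T x W : ℝ) ≤ lam * W.card) ∧ ∀ y ∈ W, (missIn T y U : ℝ) ≤ lam * U.card

theorem missOut_le_card (x : Fin n) (W : Finset (Fin n)) : missOut T x W ≤ W.card :=
  card_filter_le _ _

theorem missIn_le_card (x : Fin n) (W : Finset (Fin n)) : missIn T x W ≤ W.card :=
  card_filter_le _ _

theorem missOut_mono (x : Fin n) {W W' : Finset (Fin n)} (h : W ⊆ W') :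
    missOut T x W ≤ missOut T x W' := card_le_card (filter_subset_filter _ h)

theorem missIn_mono (x : Fin n) {W W' : Finset (Fin n)} (h : W ⊆ W') :
    missIn T x W ≤ missIn T x W' := card_le_card (filter_subset_filter _ h)

theorem sum_missOut_eq_sum_missIn (U W : Finset (Fin n)) :
    ∑ x ∈ U, (missOut T x W : ℝ) = ∑ y ∈ W, (missIn T y U : ℝ) := by
  simp only [missOut, missIn]
  exact_mod_cast sum_card_bipartiteAbove_eq_sum_card_bipartiteBelow (fun x y => ¬ T.adj x y)

theorem sparse_of_missOut_le {lam : ℝ} {U W : Finset (Fin n)}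
    (h : ∀ x ∈ U, (missOut T x W : ℝ) ≤ lam * W.card) : Sparse T lam U W := by
  refine (sum_le_sum h).trans ?_
  simp only [sum_const, nsmul_eq_mul]
  exact le_of_eq (by ring)

theorem sparse_of_missIn_le {lam : ℝ} {U W : Finset (Fin n)}
    (h : ∀ y ∈ W, (missIn T y U : ℝ) ≤ lam * U.card) : Sparse T lam U W := by
  rw [Sparse, sum_missOut_eq_sum_missIn]
  refine (sum_le_sum h).trans ?_
  simp only [sum_const, nsmul_eq_mul]
  exact le_of_eq (by ring)

theorem Sparse.mono {lam lam' : ℝ} {U W : Finset (Fin n)} (h : Sparse T lam U W)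
    (hl : lam ≤ lam') : Sparse T lam' U W := by
  refine h.trans ?_
  gcongr

theorem sparse_of_complete {lam : ℝ} (hl : 0 ≤ lam) {U W : Finset (Fin n)}
    (h : ∀ x ∈ U, ∀ y ∈ W, T.adj x y) : Sparse T lam U W := by
  refine sparse_of_missOut_le fun x hx => ?_
  have : missOut T x W = 0 := by
    rw [missOut, card_eq_zero, filter_eq_empty_iff]
    exact fun y hy => not_not.2 (h x hx y hy)
  rw [this, Nat.cast_zero]
  positivity

theorem Sparse.subset {lam a : ℝ} (hl : 0 ≤ lam) {U U' W W' : Finset (Fin n)}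
    (h : Sparse T lam U W) (hU : U' ⊆ U) (hW : W' ⊆ W) (ha : 0 ≤ a)
    (cU : (U.card : ℝ) ≤ a * U'.card) (cW : (W.card : ℝ) ≤ a * W'.card) :
    Sparse T (a ^ 2 * lam) U' W' := by
  calc ∑ x ∈ U', (missOut T x W' : ℝ) ≤ ∑ x ∈ U', (missOut T x W : ℝ) :=
        sum_le_sum fun x _ => by exact_mod_cast missOut_mono x hW
    _ ≤ ∑ x ∈ U, (missOut T x W : ℝ) :=
        sum_le_sum_of_subset_of_nonneg hU fun _ _ _ => by positivity
    _ ≤ lam * U.card * W.card := h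
    _ ≤ lam * (a * U'.card) * (a * W'.card) := by gcongr
    _ = a ^ 2 * lam * U'.card * W'.card := by ring

/-- Passing to subsets of a smooth pair of which at least one is large. -/
theorem Smooth.sparse_subset {lam k : ℝ} (hl : 0 ≤ lam) {U U' W W' : Finset (Fin n)}
    (h : Smooth T lam U W) (hU : U' ⊆ U) (hW : W' ⊆ W)
    (hc : (U.card : ℝ) ≤ k * U'.card ∨ (W.card : ℝ) ≤ k * W'.card) :
    Sparse T (k * lam) U' W' := by
  rcases hc with hc | hc
  · refine sparse_of_missIn_le fun y hy => ?_
    calc (missIn T y U' : ℝ) ≤ missIn T y U := by exact_mod_cast missIn_mono y hU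
      _ ≤ lam * U.card := h.2 y (hW hy)
      _ ≤ lam * (k * U'.card) := by gcongr
      _ = k * lam * U'.card := by ring
  · refine sparse_of_missOut_le fun y hy => ?_
    calc (missOut T y W' : ℝ) ≤ missOut T y W := by exact_mod_cast missOut_mono y hW
      _ ≤ lam * W.card := h.1 y (hU hy)
      _ ≤ lam * (k * W'.card) := by gcongr
      _ = k * lam * W'.card := by ring

theorem card_filter_markov {α : Type*} (s : Finset α) (f : α → ℝ) {a lam w : ℝ}
    (hl : 0 < lam) (f0 : ∀ x ∈ s, 0 ≤ f x) (fw : ∀ x ∈ s, f x ≤ w)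
    (hs : ∑ x ∈ s, f x ≤ lam * s.card * w) :
    a * (s.filter fun x => a * lam * w < f x).card ≤ s.card := by
  rcases (s.filter fun x => a * lam * w < f x).eq_empty_or_nonempty with he | ⟨x, hx⟩
  · rw [he]; simp
  rw [mem_filter] at hx
  have hw0 : 0 ≤ w := (f0 x hx.1).trans (fw x hx.1)
  have hw : 0 < w := by
    rcases hw0.lt_or_eq with h | h
    · exact h
    · have h1 := hx.2; have h2 := fw x hx.1
      rw [← h] at h1 h2
      simp only [mul_zero] at h1
      linarith
  have h1 : ((s.filter fun x => a * lam * w < f x).card : ℝ) * (a * lam * w) ≤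
      lam * s.card * w := by
    refine le_trans ?_ hs
    refine le_trans ?_ (sum_le_sum_of_subset_of_nonneg
      (filter_subset (fun x => a * lam * w < f x) s) fun i hi _ => f0 i hi)
    rw [← nsmul_eq_mul]
    exact card_nsmul_le_sum _ _ _ fun y hy => (mem_filter.1 hy).2.le
  have h2 : 0 < lam * w := by positivity
  refine le_of_mul_le_mul_right ?_ h2
  linarith

section Family

variable {ι : Type*} [Fintype ι] {ord : ι → ℕ} {U : ι → Finset (Fin n)}

theorem exists_good_subset {lam : ℝ} (hl : 0 < lam)
    (hU : ∀ i j, ord i < ord j → Sparse T lam (U i) (U j)) (i : ι) :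
    ∃ U' ⊆ U i, (U i).card ≤ 2 * U'.card ∧ ∀ x ∈ U', ∀ j,
      (ord i < ord j → (missOut T x (U j) : ℝ) ≤ 2 * Fintype.card ι * lam * (U j).card) ∧
      (ord j < ord i → (missIn T x (U j) : ℝ) ≤ 2 * Fintype.card ι * lam * (U j).card) := by
  set N : ℝ := (Fintype.card ι : ℝ) with hN
  have hNpos : 0 < N := by
    have : 0 < Fintype.card ι := Fintype.card_pos_iff.2 ⟨i⟩
    exact Nat.cast_pos.2 this
  let bad : ι → Finset (Fin n) := fun j =>
    if ord i < ord j then (U i).filter fun x => 2 * N * lam * (U j).card < missOut T x (U j)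
    else if ord j < ord i then (U i).filter fun x => 2 * N * lam * (U j).card < missIn T x (U j)
    else ∅
  have hbad : ∀ j, 2 * N * (bad j).card ≤ (U i).card := by
    intro j
    by_cases h1 : ord i < ord j
    · simp only [bad, h1, if_true]
      exact card_filter_markov (U i) (fun x => (missOut T x (U j) : ℝ)) hl
        (fun _ _ => by positivity) (fun x _ => by exact_mod_cast missOut_le_card x _) (hU i j h1)
    · by_cases h2 : ord j < ord i
      · simp only [bad, h1, h2, if_true, if_false]
        refine card_filter_markov (U i) (fun x => (missIn T x (U j) : ℝ)) hl
          (fun _ _ => by positivity) (fun x _ => by exact_mod_cast missIn_le_card x _) ?_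
        have := hU j i h2
        rw [Sparse, sum_missOut_eq_sum_missIn] at this
        linarith
      · simp [bad, h1, h2]
  refine ⟨U i \ univ.biUnion bad, sdiff_subset, ?_, ?_⟩
  · have h1 : ((univ.biUnion bad).card : ℝ) ≤ ∑ j, ((bad j).card : ℝ) := by
      exact_mod_cast card_biUnion_le
    have h2 : 2 * N * ∑ j, ((bad j).card : ℝ) ≤ N * (U i).card := by
      rw [mul_sum]
      refine (sum_le_sum fun j _ => hbad j).trans ?_
      simp [hN]
    have h3 : 2 * ((univ.biUnion bad).card : ℝ) ≤ (U i).card := by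
      refine le_of_mul_le_mul_left ?_ hNpos
      nlinarith
    have h4 := le_card_sdiff (univ.biUnion bad) (U i)
    have h5 : 2 * (univ.biUnion bad).card ≤ (U i).card := by exact_mod_cast h3
    omega
  · intro x hx j
    rw [mem_sdiff, mem_biUnion] at hx
    have hxj : x ∉ bad j := fun h => hx.2 ⟨j, mem_univ _, h⟩
    constructor
    · intro h1
      simp only [bad, h1, if_true, mem_filter, not_and, not_lt] at hxj
      exact hxj hx.1
    · intro h2
      simp only [bad, h2, h2.not_gt, if_true, if_false, mem_filter, not_and, not_lt] at hxj
      exact hxj hx.1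

theorem exists_smooth_subfamily {lam : ℝ} (hl : 0 < lam)
    (hU : ∀ i j, ord i < ord j → Sparse T lam (U i) (U j)) :
    ∃ V : ι → Finset (Fin n), (∀ i, V i ⊆ U i) ∧ (∀ i, (U i).card ≤ 2 * (V i).card) ∧
      ∀ i j, ord i < ord j → Smooth T (4 * Fintype.card ι * lam) (V i) (V j) := by
  choose V hV hc hg using exists_good_subset hl hU
  have hc' : ∀ i, ((U i).card : ℝ) ≤ 2 * (V i).card := fun i => by exact_mod_cast hc i
  refine ⟨V, hV, hc, fun i j hij => ⟨fun x hx => ?_, fun y hy => ?_⟩⟩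
  · calc (missOut T x (V j) : ℝ) ≤ missOut T x (U j) := by exact_mod_cast missOut_mono x (hV j)
      _ ≤ 2 * Fintype.card ι * lam * (U j).card := (hg i x hx j).1 hij
      _ ≤ 2 * Fintype.card ι * lam * (2 * (V j).card) := by gcongr; exact hc' j
      _ = _ := by ring
  · calc (missIn T y (V i) : ℝ) ≤ missIn T y (U i) := by exact_mod_cast missIn_mono y (hV i)
      _ ≤ 2 * Fintype.card ι * lam * (U i).card := (hg j y hy i).2 hij
      _ ≤ 2 * Fintype.card ι * lam * (2 * (V i).card) := by gcongr; exact hc' i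
      _ = _ := by ring

/-- Every subset of `X` has a transitive subset of at least its proportion of `t`. -/
def Ample (T : Tournament n) (X : Finset (Fin n)) (t : ℝ) : Prop :=
  ∀ A ⊆ X, ∃ S ⊆ A, T.IsTransOn S ∧ (A.card : ℝ) * t ≤ S.card * X.card

theorem Ample.exists_trans {X A : Finset (Fin n)} {t c : ℝ} (h : Ample T X t) (ht : 0 ≤ t)
    (hX : X.Nonempty) (hA : A ⊆ X) (hc : c * X.card ≤ A.card) :
    ∃ S ⊆ A, T.IsTransOn S ∧ c * t ≤ S.card := by
  obtain ⟨S, hS, hT, hle⟩ := h A hA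
  have hX' : (0 : ℝ) < X.card := by exact_mod_cast hX.card_pos
  refine ⟨S, hS, hT, le_of_mul_le_mul_right ?_ hX'⟩
  nlinarith

theorem exists_trans_subfamily {X : Finset (Fin n)} {t c lam : ℝ} (hX : X.Nonempty)
    (hL : Ample T X t) (ht : 0 ≤ t) (hl : 0 < lam) (hUX : ∀ i, U i ⊆ X)
    (hU : ∀ i j, ord i < ord j → Sparse T lam (U i) (U j)) (I : Finset ι)
    (hI : ∀ i ∈ I, c * X.card ≤ (U i).card) :
    ∃ V : ι → Finset (Fin n), (∀ i, V i ⊆ U i) ∧ (∀ i, i ∉ I → V i = U i) ∧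
      (∀ i ∈ I, T.IsTransOn (V i) ∧ c / 2 * t ≤ (V i).card) ∧
      ∀ i j, ord i < ord j → Sparse T ((2 * Fintype.card ι) ^ I.card * lam) (V i) (V j) := by
  induction I using Finset.induction_on with
  | empty => exact ⟨U, fun _ => Subset.rfl, fun _ _ => rfl, by simp, by simpa using hU⟩
  | insert a I ha ih =>
    obtain ⟨V, hV, hVe, hVt, hVs⟩ := ih fun i hi => hI i (mem_insert_of_mem hi)
    have hN : (1 : ℝ) ≤ Fintype.card ι := by
      have : 0 < Fintype.card ι := Fintype.card_pos_iff.2 ⟨a⟩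
      exact_mod_cast this
    set mu : ℝ := (2 * Fintype.card ι) ^ I.card * lam with hmu
    have hmu0 : 0 < mu := by positivity
    have hmu' : (2 * Fintype.card ι : ℝ) ^ (insert a I).card * lam = 2 * Fintype.card ι * mu := by
      rw [card_insert_of_notMem ha, pow_succ, hmu]; ring
    rw [hmu']
    have hmule : mu ≤ 2 * Fintype.card ι * mu := by nlinarith
    obtain ⟨W, hW, hWc, hWg⟩ := exists_good_subset hmu0 hVs a
    have hWX : W ⊆ X := hW.trans ((hV a).trans (hUX a))
    have hWc' : c / 2 * X.card ≤ W.card := by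
      have h1 := hI a (mem_insert_self a I)
      rw [← hVe a ha] at h1
      have h2 : ((V a).card : ℝ) ≤ 2 * W.card := by exact_mod_cast hWc
      linarith
    obtain ⟨S, hSW, hST, hSc⟩ := hL.exists_trans ht hX hWX hWc'
    refine ⟨Function.update V a S, ?_, ?_, ?_, ?_⟩
    · intro i
      rcases eq_or_ne i a with rfl | h
      · simpa using hSW.trans (hW.trans (hV i))
      · simpa [h] using hV i
    · intro i hi
      rw [mem_insert, not_or] at hi
      simpa [hi.1] using hVe i hi.2
    · intro i hi
      rcases eq_or_ne i a with rfl | h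
      · simpa using ⟨hST, hSc⟩
      · simpa [h] using hVt i (mem_of_mem_insert_of_ne hi h)
    · intro i j hij
      rcases eq_or_ne i a with rfl | hi
      · have hj : j ≠ i := by rintro rfl; exact lt_irrefl _ hij
        simp only [Function.update_self, ne_eq, hj, not_false_eq_true, Function.update_of_ne]
        exact sparse_of_missOut_le fun x hx => (hWg x (hSW hx) j).1 hij
      · rcases eq_or_ne j a with rfl | hj
        · simp only [Function.update_self, ne_eq, hi, not_false_eq_true, Function.update_of_ne]
          exact sparse_of_missIn_le fun x hx => (hWg x (hSW hx) i).2 hij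
        · simp only [ne_eq, hi, hj, not_false_eq_true, Function.update_of_ne]
          exact (hVs i j hij).mono hmule

end Family

end Sparsity

section Pieces

variable {n : ℕ} {T : Tournament n}

theorem contains_of_adj {h : ℕ} {H : Tournament h} (x : Fin h → Fin n)
    (hx : ∀ u v, H.adj u v → T.adj (x u) (x v)) : T.Contains H := by
  have hinj : Function.Injective x := by
    intro u v huv
    by_contra hne
    rcases H.total u v hne with h | h
    · exact adj_irrefl T (x v) (huv ▸ hx u v h)
    · exact adj_irrefl T (x v) (huv ▸ hx v u h)
  refine ⟨⟨x, hinj⟩, fun u v => ⟨hx u v, fun h => ?_⟩⟩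
  have hne : u ≠ v := by rintro rfl; exact adj_irrefl T _ h
  exact (H.total u v hne).resolve_right fun h' => T.asymm _ _ h (hx v u h')

theorem IsTransOn_mono {S S' : Finset (Fin n)} (h : T.IsTransOn S) (hs : S' ⊆ S) :
    T.IsTransOn S' := fun u hu v hv w hw => h u (hs hu) v (hs hv) w (hs hw)

theorem exists_source {S : Finset (Fin n)} (hT : T.IsTransOn S) (hS : S.Nonempty) :
    ∃ s ∈ S, ∀ v ∈ S, v ≠ s → T.adj s v := by
  induction S using Finset.induction_on with
  | empty => exact absurd hS not_nonempty_empty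
  | insert a S ha ih =>
    rcases S.eq_empty_or_nonempty with rfl | hne
    · exact ⟨a, by simp, by simp⟩
    · obtain ⟨s, hs, hsv⟩ := ih (IsTransOn_mono hT (subset_insert a S)) hne
      have has : a ≠ s := by rintro rfl; exact ha hs
      rcases T.total a s has with h | h
      · refine ⟨a, mem_insert_self a S, fun v hv hva => ?_⟩
        rcases eq_or_ne v s with rfl | hvs
        · exact h
        · have hvS := mem_of_mem_insert_of_ne hv hva
          exact hT a (mem_insert_self a S) s (mem_insert_of_mem hs) v hv h (hsv v hvS hvs)
      · refine ⟨s, mem_insert_of_mem hs, fun v hv hvs => ?_⟩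
        rcases eq_or_ne v a with rfl | hva
        · exact h
        · exact hsv v (mem_of_mem_insert_of_ne hv hva) hvs

/-- If `S` is transitive, the part split off can be taken to be an initial segment. -/
theorem exists_initial_subset (T : Tournament n) (S : Finset (Fin n)) (q : ℕ) (hq : q ≤ S.card) :
    ∃ P ⊆ S, P.card = q ∧ (T.IsTransOn S → ∀ x ∈ P, ∀ y ∈ S \ P, T.adj x y) := by
  by_cases hT : T.IsTransOn S
  · induction q with
    | zero => exact ⟨∅, by simp⟩
    | succ q ih =>
      obtain ⟨P, hP, hPc, hPa⟩ := ih (by omega)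
      have hne : (S \ P).Nonempty := by
        rw [← card_pos, card_sdiff_of_subset hP]; omega
      obtain ⟨s, hs, hsv⟩ := exists_source (IsTransOn_mono hT sdiff_subset) hne
      rw [mem_sdiff] at hs
      refine ⟨insert s P, insert_subset hs.1 hP, by rw [card_insert_of_notMem hs.2, hPc],
        fun _ x hx y hy => ?_⟩
      simp only [mem_sdiff, mem_insert, not_or] at hy
      rcases mem_insert.1 hx with rfl | hx
      · exact hsv y (mem_sdiff.2 ⟨hy.1, hy.2.2⟩) hy.2.1
      · exact hPa hT x hx y (mem_sdiff.2 ⟨hy.1, hy.2.2⟩)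
  · obtain ⟨P, hP, hPc⟩ := exists_subset_card_eq hq
    exact ⟨P, hP, hPc, fun h => absurd h hT⟩

theorem exists_pieces (T : Tournament n) (h q : ℕ) (S : Finset (Fin n)) (hq : h * q ≤ S.card) :
    ∃ V : Fin h → Finset (Fin n), (∀ i, V i ⊆ S ∧ (V i).card = q) ∧ ∀ i j, i < j →
      Disjoint (V i) (V j) ∧ (T.IsTransOn S → ∀ x ∈ V i, ∀ y ∈ V j, T.adj x y) := by
  induction h generalizing S with
  | zero => exact ⟨fun _ => ∅, fun i => i.elim0, fun i => i.elim0⟩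
  | succ h ih =>
    rw [add_mul, one_mul] at hq
    obtain ⟨P, hP, hPc, hPa⟩ := exists_initial_subset T S q (by omega)
    obtain ⟨V, hV, hVd⟩ := ih (S \ P) (by rw [card_sdiff_of_subset hP]; omega)
    refine ⟨Fin.cons P V, fun i => ?_, fun i j hij => ?_⟩
    · refine Fin.cases ?_ (fun i => ?_) i
      · exact ⟨hP, hPc⟩
      · exact ⟨(hV i).1.trans sdiff_subset, (hV i).2⟩
    · obtain ⟨j, rfl⟩ := Fin.exists_succ_eq.2 (Fin.ne_zero_of_lt hij)
      revert hij
      refine Fin.cases (fun _ => ?_) (fun i hij => ?_) i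
      · exact ⟨disjoint_sdiff.mono_right (hV j).1,
          fun hT x hx y hy => hPa hT x hx y ((hV j).1 hy)⟩
      · have := hVd i j (Fin.succ_lt_succ_iff.1 hij)
        exact ⟨this.1, fun hT => this.2 (IsTransOn_mono hT sdiff_subset)⟩

theorem exists_transversal_or_sparse {lam : ℝ} (hl : 0 < lam) (k : ℕ) :
    ∃ c : ℝ, 0 < c ∧ ∀ (n : ℕ) (T : Tournament n) (R : Fin k → Fin k → Prop)
      (V : Fin k → Finset (Fin n)), (∀ i, (V i).Nonempty) →
      (∀ i j, i ≠ j → Disjoint (V i) (V j)) →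
      (∃ x : Fin k → Fin n, (∀ i, x i ∈ V i) ∧ ∀ i j, i < j →
        (R i j → T.adj (x i) (x j)) ∧ (¬ R i j → T.adj (x j) (x i))) ∨
      ∃ i j, i ≠ j ∧ ∃ A ⊆ V i, ∃ B ⊆ V j, c * (V i).card ≤ A.card ∧
        c * (V j).card ≤ B.card ∧ Sparse T lam A B := by
  induction k with
  | zero => exact ⟨1, one_pos, fun n T R V _ _ => Or.inl ⟨fun i => i.elim0, fun i => i.elim0,
      fun i => i.elim0⟩⟩
  | succ k ih =>
    obtain ⟨c, hc, ih⟩ := ih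
    have hk : (0 : ℝ) < k + 1 := by positivity
    refine ⟨min (c * lam) (1 / (k + 1)), by positivity, fun n T R V hV hd => ?_⟩
    set c' : ℝ := min (c * lam) (1 / (k + 1)) with hc'
    have hc1 : c' ≤ c * lam := min_le_left _ _
    have hc2 : c' ≤ 1 / (k + 1) := min_le_right _ _
    have hc3 : c' ≤ 1 := hc2.trans (by rw [div_le_one hk]; linarith [(Nat.cast_nonneg k : (0:ℝ) ≤ k)])
    let ok : Fin n → Fin k → Finset (Fin n) := fun v j =>
      (V j.succ).filter fun y => (R 0 j.succ → T.adj v y) ∧ (¬ R 0 j.succ → T.adj y v)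
    by_cases hgood : ∃ v ∈ V 0, ∀ j, lam * (V j.succ).card ≤ (ok v j).card
    · obtain ⟨v, hv, hvj⟩ := hgood
      have hok : ∀ j, ok v j ⊆ V j.succ := fun j => filter_subset _ _
      have hne : ∀ j, (ok v j).Nonempty := by
        intro j
        rw [← card_pos]
        have : (0 : ℝ) < (V j.succ).card := by exact_mod_cast (hV j.succ).card_pos
        have h2 := hvj j
        have h3 : (0 : ℝ) < (ok v j).card := lt_of_lt_of_le (by positivity) h2
        exact_mod_cast h3
      rcases ih n T (fun i j => R i.succ j.succ) (ok v) hne (fun i j hij =>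
        (hd i.succ j.succ (by simpa using hij)).mono (hok i) (hok j)) with
        ⟨x, hx, hxa⟩ | ⟨i, j, hij, A, hA, B, hB, hAc, hBc, hs⟩
      · refine Or.inl ⟨Fin.cons v x, ?_, ?_⟩
        · intro i
          refine Fin.cases hv (fun i => ?_) i
          exact hok i (hx i)
        · intro i j hij
          obtain ⟨j, rfl⟩ := Fin.exists_succ_eq.2 (Fin.ne_zero_of_lt hij)
          revert hij
          refine Fin.cases (fun _ => ?_) (fun i hij => ?_) i
          · exact (mem_filter.1 (hx j)).2
          · exact hxa i j (Fin.succ_lt_succ_iff.1 hij)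
      · refine Or.inr ⟨i.succ, j.succ, by simpa using hij, A, hA.trans (hok i), B,
          hB.trans (hok j), ?_, ?_, hs⟩
        · calc c' * (V i.succ).card ≤ c * lam * (V i.succ).card := by gcongr
            _ = c * (lam * (V i.succ).card) := by ring
            _ ≤ c * (ok v i).card := by gcongr; exact hvj i
            _ ≤ _ := hAc
        · calc c' * (V j.succ).card ≤ c * lam * (V j.succ).card := by gcongr
            _ = c * (lam * (V j.succ).card) := by ring
            _ ≤ c * (ok v j).card := by gcongr; exact hvj j
            _ ≤ _ := hBc
    · push Not at hgood
      have hex : ∀ v, ∃ j : Fin k, v ∈ V 0 → ((ok v j).card : ℝ) < lam * (V j.succ).card := by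
        intro v
        by_cases hv : v ∈ V 0
        · obtain ⟨j, hj⟩ := hgood v hv
          exact ⟨j, fun _ => hj⟩
        · obtain ⟨j, -⟩ := hgood _ (hV 0).choose_spec
          exact ⟨j, fun h => absurd h hv⟩
      choose f hf using hex
      have hkne : (univ : Finset (Fin k)).Nonempty := ⟨f (hV 0).choose, mem_univ _⟩
      obtain ⟨j, -, hj⟩ := exists_le_card_fiber_of_nsmul_le_card_of_maps_to (s := V 0)
        (t := (univ : Finset (Fin k))) (f := f) (b := c' * (V 0).card)
        (fun _ _ => mem_univ _) hkne (by
          rw [nsmul_eq_mul, card_univ, Fintype.card_fin]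
          have : (k : ℝ) * c' ≤ 1 := by
            have h1 : (k : ℝ) * c' ≤ (k + 1) * c' := by
              have : 0 < c' := by positivity
              nlinarith
            refine h1.trans ?_
            rw [le_div_iff₀ hk] at hc2
            linarith
          have h0 : (0 : ℝ) ≤ (V 0).card := by positivity
          nlinarith)
      set A := (V 0).filter fun x => f x = j with hA
      have hAf : ∀ v ∈ A, ((ok v j).card : ℝ) ≤ lam * (V j.succ).card := by
        intro v hv
        rw [hA, mem_filter] at hv
        rw [← hv.2]
        exact (hf v hv.1).le
      have hAV : A ⊆ V 0 := filter_subset _ _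
      have hdj : ∀ v ∈ A, ∀ y ∈ V j.succ, v ≠ y := by
        rintro v hv y hy rfl
        exact disjoint_left.1 (hd 0 j.succ (Fin.succ_ne_zero j).symm) (hAV hv) hy
      have hB : c' * (V j.succ).card ≤ (V j.succ).card := by
        have h0 : (0 : ℝ) ≤ (V j.succ).card := by positivity
        nlinarith
      by_cases hR : R 0 j.succ
      · refine Or.inr ⟨j.succ, 0, Fin.succ_ne_zero j, V j.succ, Subset.rfl, A, hAV, hB, hj, ?_⟩
        refine sparse_of_missIn_le fun v hv => le_trans ?_ (hAf v hv)
        refine Nat.cast_le.2 (card_le_card fun y hy => ?_)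
        rw [mem_filter] at hy ⊢
        exact ⟨hy.1, fun _ => adj_of_not_adj (hdj v hv y hy.1).symm hy.2, fun h => absurd hR h⟩
      · refine Or.inr ⟨0, j.succ, (Fin.succ_ne_zero j).symm, A, hAV, V j.succ, Subset.rfl, hj, hB, ?_⟩
        refine sparse_of_missOut_le fun v hv => le_trans ?_ (hAf v hv)
        refine Nat.cast_le.2 (card_le_card fun y hy => ?_)
        rw [mem_filter] at hy ⊢
        exact ⟨hy.1, fun h => absurd h hR, fun _ => adj_of_not_adj (hdj v hv y hy.1) hy.2⟩

theorem le_two_mul_mul_div {h s : ℕ} (hh : 0 < h) (hs : h ≤ s) : s ≤ 2 * h * (s / h) := by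
  have h1 := Nat.div_add_mod s h
  have h2 := Nat.mod_lt s hh
  have h3 : 1 ≤ s / h := (Nat.one_le_div_iff hh).2 hs
  nlinarith

theorem exists_sparse_pair {h : ℕ} (H : Tournament h) {lam : ℝ} (hl : 0 < lam) :
    ∃ c : ℝ, 0 < c ∧ ∀ (n : ℕ) (T : Tournament n) (X : Finset (Fin n)), ¬ T.Contains H →
      h ≤ X.card → ∃ A ⊆ X, ∃ B ⊆ X, Disjoint A B ∧ c * X.card ≤ A.card ∧ c * X.card ≤ B.card ∧
        Sparse T lam A B := by
  rcases Nat.eq_zero_or_pos h with rfl | hh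
  · exact ⟨1, one_pos, fun n T X hT _ => absurd (contains_of_adj (fun i => i.elim0)
      fun i => i.elim0) hT⟩
  obtain ⟨c, hc, hmain⟩ := exists_transversal_or_sparse hl h
  have hh' : (0 : ℝ) < h := by exact_mod_cast hh
  refine ⟨c / (2 * h), by positivity, fun n T X hT hX => ?_⟩
  obtain ⟨V, hV, hVd⟩ := exists_pieces T h (X.card / h) X (Nat.mul_div_le _ _)
  have hVne : ∀ i, (V i).Nonempty := by
    intro i
    rw [← card_pos, (hV i).2]
    exact Nat.div_pos hX hh
  have hVd' : ∀ i j, i ≠ j → Disjoint (V i) (V j) := by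
    intro i j hij
    rcases lt_or_gt_of_ne hij with h | h
    · exact (hVd i j h).1
    · exact (hVd j i h).1.symm
  have hVc : ∀ i, c / (2 * h) * X.card ≤ c * (V i).card := by
    intro i
    rw [(hV i).2]
    have : (X.card : ℝ) ≤ 2 * h * ((X.card / h : ℕ) : ℝ) := by
      exact_mod_cast le_two_mul_mul_div hh hX
    rw [div_mul_eq_mul_div, div_le_iff₀ (by positivity)]
    nlinarith
  rcases hmain n T H.adj V hVne hVd' with ⟨x, -, hx⟩ | ⟨i, j, hij, A, hA, B, hB, hAc, hBc, hs⟩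
  · refine absurd (contains_of_adj x fun u v huv => ?_) hT
    have hne : u ≠ v := by rintro rfl; exact adj_irrefl H _ huv
    rcases lt_or_gt_of_ne hne with h | h
    · exact (hx u v h).1 huv
    · exact (hx v u h).2 (H.asymm _ _ huv)
  · exact ⟨A, hA.trans (hV i).1, B, hB.trans (hV j).1, (hVd' i j hij).mono hA hB,
      (hVc i).trans hAc, (hVc j).trans hBc, hs⟩

theorem exists_sparse_family {h : ℕ} (H : Tournament h) (k : ℕ) {lam : ℝ} (hl : 0 < lam) :
    ∃ c : ℝ, 0 < c ∧ c ≤ 1 ∧ ∃ m : ℕ, ∀ (n : ℕ) (T : Tournament n) (X : Finset (Fin n)),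
      ¬ T.Contains H → m ≤ X.card → ∃ U : Fin k → Finset (Fin n),
        (∀ i, U i ⊆ X ∧ c * X.card ≤ (U i).card) ∧
        ∀ i j, i < j → Disjoint (U i) (U j) ∧ Sparse T lam (U i) (U j) := by
  induction k with
  | zero => exact ⟨1, one_pos, le_rfl, 0, fun n T X _ _ =>
      ⟨fun _ => ∅, fun i => i.elim0, fun i => i.elim0⟩⟩
  | succ k ih =>
    obtain ⟨c, hc, hc1, m, ih⟩ := ih
    obtain ⟨d, hd, hpair⟩ := exists_sparse_pair H (lam := lam * c ^ 2) (by positivity)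
    refine ⟨min d 1 * c, by positivity, ?_, max h ⌈m / d⌉₊, fun n T X hT hX => ?_⟩
    · have : min d 1 ≤ 1 := min_le_right _ _
      nlinarith
    · obtain ⟨A, hA, B, hB, hAB, hAc, hBc, hs⟩ := hpair n T X hT ((le_max_left _ _).trans hX)
      have hmX : (m : ℝ) / d ≤ X.card :=
        (Nat.le_ceil _).trans (Nat.cast_le.2 ((le_max_right _ _).trans hX))
      have hmB : m ≤ B.card := by
        rw [div_le_iff₀ hd] at hmX
        have : (m : ℝ) ≤ B.card := by linarith
        exact_mod_cast this
      obtain ⟨U, hU, hUp⟩ := ih n T B hT hmB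
      have hX0 : (0 : ℝ) ≤ X.card := by positivity
      have hdX : min d 1 * X.card ≤ d * X.card := by gcongr; exact min_le_left _ _
      refine ⟨Fin.cons A U, fun i => ?_, fun i j hij => ?_⟩
      · refine Fin.cases ⟨hA, ?_⟩ (fun i => ⟨(hU i).1.trans hB, ?_⟩) i
        · have h1 : min d 1 * c * X.card ≤ min d 1 * X.card := by
            have : 0 ≤ min d 1 * X.card := by positivity
            nlinarith
          simpa using h1.trans (hdX.trans hAc)
        · have h2 := (hU i).2
          have h3 : c * (min d 1 * X.card) ≤ c * B.card := by gcongr; exact hdX.trans hBc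
          simp only [Fin.cons_succ]
          linarith
      · obtain ⟨j, rfl⟩ := Fin.exists_succ_eq.2 (Fin.ne_zero_of_lt hij)
        revert hij
        refine Fin.cases (fun _ => ?_) (fun i hij => ?_) i
        · simp only [Fin.cons_zero, Fin.cons_succ]
          refine ⟨hAB.mono_right (hU j).1, ?_⟩
          have hci : 1 ≤ 1 / c := by rw [le_div_iff₀ hc]; linarith
          have h1 := hs.subset (a := 1 / c) (by positivity) Subset.rfl (hU j).1 (by positivity)
            (by
              have : (0 : ℝ) ≤ A.card := by positivity
              nlinarith)
            (by
              have := (hU j).2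
              rw [div_mul_eq_mul_div, le_div_iff₀ hc]
              linarith)
          refine h1.mono (le_of_eq ?_)
          field_simp
        · simpa using hUp i j (Fin.succ_lt_succ_iff.1 hij)

end Pieces

section Gadgets

variable {n : ℕ} {T : Tournament n}

/-- A decomposition of `H` into parts `G q` such that all backward arcs lie within parts. -/
structure IsGadgetDecomp {h : ℕ} (H : Tournament h) (θ : Equiv.Perm (Fin h)) {κ : Type}
    (G : κ → Finset (Fin h)) : Prop where
  cover : ∀ v, ∃ q, v ∈ G q
  disj : ∀ p q, p ≠ q → Disjoint (G p) (G q)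
  back : ∀ u v, H.Backward θ u v → ∃ q, u ∈ G q ∧ v ∈ G q

/-- The vertices of `G` can be embedded in the cells `W`. -/
def Realizes {h : ℕ} (T : Tournament n) (H : Tournament h) (G : Finset (Fin h))
    (W : Fin h → Finset (Fin n)) : Prop :=
  ∃ x : Fin h → Fin n, (∀ v ∈ G, x v ∈ W v) ∧
    ∀ u ∈ G, ∀ v ∈ G, H.adj u v → T.adj (x u) (x v)

theorem IsGadgetDecomp.pos_lt {h : ℕ} {H : Tournament h} {θ : Equiv.Perm (Fin h)} {κ : Type}
    {G : κ → Finset (Fin h)} (hG : IsGadgetDecomp H θ G) {p q : κ} (hpq : p ≠ q) {u v : Fin h}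
    (hu : u ∈ G p) (hv : v ∈ G q) (huv : H.adj u v) : pos θ u < pos θ v := by
  by_contra hlt
  have hne : pos θ u ≠ pos θ v := fun he => by
    have : u = v := θ.symm.injective he
    exact adj_irrefl H v (this ▸ huv)
  obtain ⟨r, hur, hvr⟩ := hG.back u v ⟨huv, lt_of_le_of_ne (not_lt.1 hlt) hne.symm⟩
  have h1 : r = p := by
    by_contra h; exact disjoint_left.1 (hG.disj r p h) hur hu
  have h2 : r = q := by
    by_contra h; exact disjoint_left.1 (hG.disj r q h) hvr hv
  exact hpq (h1.symm.trans h2)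

theorem contains_of_gadgets {h : ℕ} {H : Tournament h} {θ : Equiv.Perm (Fin h)} {κ : Type}
    [Fintype κ] {G : κ → Finset (Fin h)} (hG : IsGadgetDecomp H θ G)
    {V : Fin h → Finset (Fin n)} {lam : ℝ} (hlam : 2 * h * lam ≤ 1)
    (hV : ∀ u v, pos θ u < pos θ v → Smooth T lam (V u) (V v))
    (hgad : ∀ q, ∀ W : Fin h → Finset (Fin n), (∀ v, W v ⊆ V v) →
      (∀ v, (V v).card ≤ 2 * (W v).card) → Realizes T H (G q) W) : T.Contains H := by
  suffices key : ∀ s : Finset κ, ∃ x : Fin h → Fin n, (∀ q ∈ s, ∀ v ∈ G q, x v ∈ V v) ∧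
      ∀ p ∈ s, ∀ q ∈ s, ∀ u ∈ G p, ∀ v ∈ G q, H.adj u v → T.adj (x u) (x v) by
    obtain ⟨x, -, hx⟩ := key univ
    refine contains_of_adj x fun u v huv => ?_
    obtain ⟨p, hp⟩ := hG.cover u
    obtain ⟨q, hq⟩ := hG.cover v
    exact hx p (mem_univ _) q (mem_univ _) u hp v hq huv
  intro s
  induction s using Finset.induction_on with
  | empty =>
    rcases isEmpty_or_nonempty (Fin h) with he | ⟨⟨v⟩⟩
    · exact ⟨fun v => he.elim v, by simp, by simp⟩
    · obtain ⟨q, -⟩ := hG.cover v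
      obtain ⟨x, -⟩ := hgad q V (fun _ => Subset.rfl) (fun _ => by omega)
      exact ⟨x, by simp, by simp⟩
  | insert a s ha ih =>
    obtain ⟨x, hxV, hxa⟩ := ih
    let W : Fin h → Finset (Fin n) := fun v => (V v).filter fun y => ∀ q ∈ s, ∀ u ∈ G q,
      (pos θ u < pos θ v → T.adj (x u) y) ∧ (pos θ v < pos θ u → T.adj y (x u))
    have hWc : ∀ v, (V v).card ≤ 2 * (W v).card := by
      intro v
      let D : Finset (Fin h) := univ.filter fun u => ∃ q ∈ s, u ∈ G q
      let bad : Fin h → Finset (Fin n) := fun u => (V v).filter fun y =>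
        ¬ ((pos θ u < pos θ v → T.adj (x u) y) ∧ (pos θ v < pos θ u → T.adj y (x u)))
      have hbad : ∀ u ∈ D, 2 * h * ((bad u).card : ℝ) ≤ (V v).card := by
        intro u hu
        obtain ⟨q, hq, huq⟩ := (mem_filter.1 hu).2
        have hVv : (0 : ℝ) ≤ (V v).card := by positivity
        have hle : ((bad u).card : ℝ) ≤ lam * (V v).card ∨ (bad u).card = 0 := by
          rcases lt_trichotomy (pos θ u) (pos θ v) with h | h | h
          · left
            refine le_trans (Nat.cast_le.2 (card_le_card fun y hy => ?_))
              ((hV u v h).1 (x u) (hxV q hq u huq))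
            simpa [bad, h, h.not_gt] using hy
          · right
            simp [bad, h]
          · left
            refine le_trans (Nat.cast_le.2 (card_le_card fun y hy => ?_))
              ((hV v u h).2 (x u) (hxV q hq u huq))
            simpa [bad, h, h.not_gt] using hy
        rcases hle with hle | hle
        · calc 2 * h * ((bad u).card : ℝ) ≤ 2 * h * (lam * (V v).card) := by gcongr
            _ = (2 * h * lam) * (V v).card := by ring
            _ ≤ _ := by nlinarith
        · rw [hle]; simp
      have hsub : V v \ W v ⊆ D.biUnion bad := by
        intro y hy
        simp only [W, mem_sdiff, mem_filter, not_and] at hy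
        have h2 := hy.2 hy.1
        push Not at h2
        obtain ⟨q, hq, u, hu, huy⟩ := h2
        refine mem_biUnion.2 ⟨u, mem_filter.2 ⟨mem_univ _, q, hq, hu⟩, mem_filter.2 ⟨hy.1, ?_⟩⟩
        rintro ⟨h1, h2⟩
        obtain ⟨h3, h4⟩ := huy h1
        exact h4 (h2 h3)
      have hh : (0 : ℝ) < h := by
        have : 0 < h := v.pos
        exact_mod_cast this
      have h1 : ((V v \ W v).card : ℝ) ≤ ∑ u ∈ D, ((bad u).card : ℝ) := by
        exact_mod_cast (card_le_card hsub).trans card_biUnion_le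
      have h2 : 2 * h * ∑ u ∈ D, ((bad u).card : ℝ) ≤ h * (V v).card := by
        rw [mul_sum]
        refine (sum_le_sum hbad).trans ?_
        rw [sum_const, nsmul_eq_mul]
        gcongr
        simpa using card_le_univ D
      have h3 : 2 * ((V v \ W v).card : ℝ) ≤ (V v).card := by
        refine le_of_mul_le_mul_left ?_ hh
        nlinarith
      have h4 : 2 * (V v \ W v).card ≤ (V v).card := by exact_mod_cast h3
      have h5 := card_sdiff_add_card_eq_card (show W v ⊆ V v from filter_subset _ _)
      omega
    obtain ⟨y, hyW, hya⟩ := hgad a W (fun v => filter_subset _ _) hWc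
    have hnot : ∀ q ∈ s, ∀ u ∈ G q, u ∉ G a := fun q hq u hu hua =>
      disjoint_left.1 (hG.disj q a (by rintro rfl; exact ha hq)) hu hua
    refine ⟨fun v => if v ∈ G a then y v else x v, ?_, ?_⟩
    · intro q hq v hv
      rcases mem_insert.1 hq with rfl | hq
      · simpa [hv] using filter_subset _ _ (hyW v hv)
      · simpa [hnot q hq v hv] using hxV q hq v hv
    · intro p hp q hq u hu v hv huv
      rcases mem_insert.1 hp with rfl | hp' <;> rcases mem_insert.1 hq with rfl | hq'
      · simpa [hu, hv] using hya u hu v hv huv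
      · have hlt := hG.pos_lt (by rintro rfl; exact ha hq') hu hv huv
        simpa [hu, hnot q hq' v hv] using ((mem_filter.1 (hyW u hu)).2 q hq' v hv).2 hlt
      · have hlt := hG.pos_lt (by rintro rfl; exact ha hp') hu hv huv
        simpa [hv, hnot p hp' u hu] using ((mem_filter.1 (hyW v hv)).2 p hp' u hu).1 hlt
      · simpa [hnot p hp' u hu, hnot q hq' v hv] using hxa p hp' q hq' u hu v hv huv

/-- The cells in which the gadgets have to be realized: `b` assigns to each vertex of `H` the index
of its block; cells in odd blocks are transitive. -/
structure IsCellFamily {h N : ℕ} (T : Tournament n) (θ : Equiv.Perm (Fin h)) (b : Fin h → Fin N)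
    (U : Fin N → Finset (Fin n)) (r : ℝ) (W : Fin h → Finset (Fin n)) : Prop where
  subset : ∀ v, W v ⊆ U (b v)
  even : ∀ v, Even (b v).val → (U (b v)).card ≤ 4 * (W v).card
  odd : ∀ v, ¬ Even (b v).val → T.IsTransOn (W v) ∧ r ≤ (W v).card
  complete : ∀ u v, pos θ u < pos θ v → b u = b v → ∀ x ∈ W u, ∀ y ∈ W v, T.adj x y

theorem exists_sparsity_threshold (h N : ℕ) : ∃ lam : ℝ, 0 < lam ∧ ∀ {n : ℕ} {T : Tournament n}
    {X : Finset (Fin n)} {t c : ℝ} {H : Tournament h} {θ : Equiv.Perm (Fin h)} {κ : Type}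
    [Fintype κ] {G : κ → Finset (Fin h)} {b : Fin h → Fin N} {U : Fin N → Finset (Fin n)},
    IsGadgetDecomp H θ G →
    (∀ u v, pos θ u < pos θ v → b u < b v ∨ (b u = b v ∧ ¬ Even (b u).val)) →
    X.Nonempty → Ample T X t → 0 ≤ t → 0 < c → 2 * h ≤ c * t → (∀ i, U i ⊆ X) →
    (∀ i j, i < j → Sparse T lam (U i) (U j)) →
    (∀ i, ¬ Even i.val → c * X.card ≤ (U i).card ∨ (T.IsTransOn (U i) ∧ c * t ≤ (U i).card)) →
    (∀ q W, IsCellFamily T θ b U (c * t / (16 * h)) W → Realizes T H (G q) W) →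
    T.Contains H := by
  set D : ℝ := 2 * h * (4 * h * ((2 * h) ^ 2 * (2 * N + 1) ^ N)) + 1 with hD
  have hD0 : 0 < D := by positivity
  refine ⟨1 / D, by positivity, ?_⟩
  intro n T X t c H θ κ _ G b U hG hb hX hL ht hc hct hUX hU hodd hgad
  set lam : ℝ := 1 / D with hlam
  have hlam0 : 0 < lam := by positivity
  obtain ⟨V, hV, hVe, hVt, hVs⟩ := exists_trans_subfamily (ord := fun i : Fin N => i.val) (c := c)
    hX hL ht hlam0 hUX hU (univ.filter fun i : Fin N => ¬ Even i.val ∧ c * X.card ≤ (U i).card)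
    (fun i hi => (mem_filter.1 hi).2.2)
  set I := univ.filter fun i : Fin N => ¬ Even i.val ∧ c * X.card ≤ (U i).card with hI
  have hVeven : ∀ i : Fin N, Even i.val → V i = U i := fun i hi =>
    hVe i (by simp [hI, hi])
  have hVodd : ∀ i : Fin N, ¬ Even i.val → T.IsTransOn (V i) ∧ c * t / 2 ≤ (V i).card := by
    intro i hi
    by_cases hiI : i ∈ I
    · have := hVt i hiI
      exact ⟨this.1, by linarith⟩
    · rw [hVe i hiI]
      have h1 : ¬ (c * X.card ≤ (U i).card) := fun h => hiI (mem_filter.2 ⟨mem_univ _, hi, h⟩)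
      have h2 := (hodd i hi).resolve_left h1
      exact ⟨h2.1, by have : 0 ≤ c * t := by positivity
                      linarith [h2.2]⟩
  set mu : ℝ := (2 * N + 1) ^ N * lam with hmu
  have hmu0 : 0 < mu := by positivity
  have hVs' : ∀ i j : Fin N, i < j → Sparse T mu (V i) (V j) := by
    intro i j hij
    refine (hVs i j hij).mono ?_
    rw [hmu, Fintype.card_fin]
    gcongr
    calc (2 * N : ℝ) ^ I.card ≤ (2 * N + 1) ^ I.card := by gcongr; linarith
      _ ≤ (2 * N + 1) ^ N := by
        refine pow_le_pow_right₀ (by linarith [(Nat.cast_nonneg N : (0:ℝ) ≤ N)]) ?_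
        simpa using card_le_univ I
  choose P hP hPd using fun i => exists_pieces T h ((V i).card / h) (V i) (Nat.mul_div_le _ _)
  let V₁ : Fin h → Finset (Fin n) := fun v =>
    if Even (b v).val then V (b v) else P (b v) (pos θ v)
  have hV₁sub : ∀ v, V₁ v ⊆ V (b v) := by
    intro v
    by_cases hv : Even (b v).val
    · simp [V₁, hv]
    · simpa [V₁, hv] using (hP (b v) (pos θ v)).1
  have hV₁card : ∀ v, ((V (b v)).card : ℝ) ≤ 2 * h * (V₁ v).card := by
    intro v
    have hh : (1 : ℝ) ≤ h := by exact_mod_cast v.pos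
    by_cases hv : Even (b v).val
    · have : (0 : ℝ) ≤ (V (b v)).card := by positivity
      simp only [V₁, hv, if_true]
      nlinarith
    · have h1 : h ≤ (V (b v)).card := by
        have := (hVodd (b v) hv).2
        have h2 : (h : ℝ) ≤ (V (b v)).card := by linarith
        exact_mod_cast h2
      simp only [V₁, hv, if_false, (hP (b v) (pos θ v)).2]
      exact_mod_cast le_two_mul_mul_div v.pos h1
  have hV₁comp : ∀ u v, pos θ u < pos θ v → b u = b v → ∀ x ∈ V₁ u, ∀ y ∈ V₁ v, T.adj x y := by
    intro u v huv hbuv x hx y hy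
    have hu : ¬ Even (b u).val := by
      rcases hb u v huv with h | h
      · exact absurd hbuv h.ne
      · exact h.2
    have hv : ¬ Even (b v).val := hbuv ▸ hu
    simp only [V₁, hu, hv, if_false] at hx hy
    rw [← hbuv] at hy
    exact (hPd (b u) _ _ huv).2 (hVodd _ hu).1 x hx y hy
  have hV₁s : ∀ u v, pos θ u < pos θ v → Sparse T ((2 * h) ^ 2 * mu) (V₁ u) (V₁ v) := by
    intro u v huv
    rcases hb u v huv with h | h
    · exact (hVs' _ _ h).subset hmu0.le (hV₁sub u) (hV₁sub v) (by positivity)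
        (hV₁card u) (hV₁card v)
    · exact sparse_of_complete (by positivity) (hV₁comp u v huv h.1)
  rcases Nat.eq_zero_or_pos h with rfl | hh
  · exact contains_of_adj (fun i => i.elim0) fun i => i.elim0
  have hh' : (0 : ℝ) < h := by exact_mod_cast hh
  obtain ⟨V₂, hV₂, hV₂c, hV₂s⟩ := exists_smooth_subfamily (ord := fun v => (pos θ v).val)
    (U := V₁) (by positivity) hV₁s
  rw [Fintype.card_fin] at hV₂s
  refine contains_of_gadgets hG ?_ hV₂s fun q W hW hWc => hgad q W ⟨?_, ?_, ?_, ?_⟩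
  · rw [show 2 * (h : ℝ) * (4 * h * ((2 * h) ^ 2 * mu)) = (D - 1) * lam by rw [hD, hmu]; ring,
      hlam, mul_one_div, div_le_one hD0]
    linarith
  · exact fun v => (hW v).trans ((hV₂ v).trans ((hV₁sub v).trans (hV (b v))))
  · intro v hv
    have h1 := hV₂c v
    have h2 := hWc v
    simp only [V₁, hv, if_true, hVeven] at h1
    omega
  · intro v hv
    refine ⟨IsTransOn_mono (hVodd (b v) hv).1 ((hW v).trans ((hV₂ v).trans (hV₁sub v))), ?_⟩
    have h1 : ((V₁ v).card : ℝ) ≤ 4 * (W v).card := by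
      have h1 := hV₂c v
      have h2 := hWc v
      have h3 : (V₁ v).card ≤ 4 * (W v).card := by omega
      exact_mod_cast h3
    have h2 := hV₁card v
    have h3 := (hVodd (b v) hv).2
    rw [div_le_iff₀ (by positivity)]
    nlinarith
  · exact fun u v huv hbuv x hx y hy =>
      hV₁comp u v huv hbuv x (hV₂ u (hW u hx)) y (hV₂ v (hW v hy))

end Gadgets

section Frames

variable {n : ℕ} {T : Tournament n}

/-- No large subset of `X` is complete to or from a large transitive subset of `X`. -/
def Unsplit (T : Tournament n) (X : Finset (Fin n)) (δ t : ℝ) : Prop :=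
  ∀ A ⊆ X, ∀ S ⊆ X, δ * X.card ≤ A.card → T.IsTransOn S → δ * t ≤ S.card → Disjoint A S →
    (¬ ∀ a ∈ A, ∀ s ∈ S, T.adj a s) ∧ ¬ ∀ a ∈ A, ∀ s ∈ S, T.adj s a

theorem Unsplit.card_le {X A : Finset (Fin n)} {δ t : ℝ} (hU : Unsplit T X δ t) (hδ : 0 ≤ δ)
    (hA : A ⊆ X) {h : ℕ} {L : Finset (Fin h)} {W : Fin h → Finset (Fin n)}
    (hW : ∀ l ∈ L, W l ⊆ X ∧ T.IsTransOn (W l) ∧ δ * t ≤ (W l).card ∧ Disjoint A (W l))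
    {R : Fin n → Fin n → Prop} (hR : R = T.adj ∨ R = fun x y => T.adj y x) :
    (A.card : ℝ) ≤ (A.filter fun x => ∀ l ∈ L, ∃ y ∈ W l, R x y).card + h * (δ * X.card) := by
  let bad : Fin h → Finset (Fin n) := fun l => A.filter fun x => ∀ y ∈ W l, ¬ R x y
  have hbad : ∀ l ∈ L, ((bad l).card : ℝ) ≤ δ * X.card := by
    intro l hl
    obtain ⟨h1, h2, h3, h4⟩ := hW l hl
    by_contra hlt
    have h5 := hU (bad l) ((filter_subset _ _).trans hA) (W l) h1 (not_le.1 hlt).le h2 h3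
      (h4.mono_left (filter_subset _ _))
    have hne : ∀ a ∈ bad l, ∀ s ∈ W l, a ≠ s := fun a ha s hs => by
      rintro rfl
      exact disjoint_left.1 h4 (filter_subset _ _ ha) hs
    rcases hR with rfl | rfl
    · exact h5.2 fun a ha s hs => adj_of_not_adj (hne a ha s hs) ((mem_filter.1 ha).2 s hs)
    · exact h5.1 fun a ha s hs => adj_of_not_adj (hne a ha s hs).symm ((mem_filter.1 ha).2 s hs)
  have hsub : A ⊆ (A.filter fun x => ∀ l ∈ L, ∃ y ∈ W l, R x y) ∪ L.biUnion bad := by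
    intro x hx
    by_cases hx2 : ∀ l ∈ L, ∃ y ∈ W l, R x y
    · exact mem_union_left _ (mem_filter.2 ⟨hx, hx2⟩)
    · push Not at hx2
      obtain ⟨l, hl, hy⟩ := hx2
      exact mem_union_right _ (mem_biUnion.2 ⟨l, hl, mem_filter.2 ⟨hx, hy⟩⟩)
  have h1 : (A.card : ℝ) ≤ (A.filter fun x => ∀ l ∈ L, ∃ y ∈ W l, R x y).card +
      ∑ l ∈ L, ((bad l).card : ℝ) := by
    exact_mod_cast (card_le_card hsub).trans ((card_union_le _ _).trans
      (Nat.add_le_add_left card_biUnion_le _))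
  have h2 : ∑ l ∈ L, ((bad l).card : ℝ) ≤ h * (δ * X.card) := by
    refine (sum_le_sum hbad).trans ?_
    rw [sum_const, nsmul_eq_mul]
    gcongr
    simpa using card_le_univ L
  linarith

/-- Pairwise disjoint sets `U i` inside `X`, almost complete forwards; sets of even index are
large, sets of odd index are large or transitive. -/
structure IsFrame (T : Tournament n) (X : Finset (Fin n)) (t c lam : ℝ) {N : ℕ}
    (U : Fin N → Finset (Fin n)) : Prop where
  subset : ∀ i, U i ⊆ X
  disj : ∀ i j, i < j → Disjoint (U i) (U j)
  sparse : ∀ i j, i < j → Sparse T lam (U i) (U j)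
  even : ∀ i, Even i.val → c * X.card ≤ (U i).card
  odd : ∀ i, ¬ Even i.val → c * X.card ≤ (U i).card ∨ (T.IsTransOn (U i) ∧ c * t ≤ (U i).card)

theorem IsFrame.disjoint {X : Finset (Fin n)} {t c lam : ℝ} {N : ℕ} {U : Fin N → Finset (Fin n)}
    (hU : IsFrame T X t c lam U) {i j : Fin N} (hij : i ≠ j) : Disjoint (U i) (U j) := by
  rcases lt_or_gt_of_ne hij with h | h
  · exact hU.disj i j h
  · exact (hU.disj j i h).symm

section Cells

variable {h N : ℕ} {H : Tournament h} {θ : Equiv.Perm (Fin h)} {b : Fin h → Fin N}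
  {U : Fin N → Finset (Fin n)} {W : Fin h → Finset (Fin n)} {X : Finset (Fin n)}
  {t c δ lam : ℝ}

/-- A center in an even cell, outside a small exceptional set, has neighbours in all given
odd cells. -/
theorem IsCellFamily.card_le (hU : Unsplit T X δ t) (hF : IsFrame T X t c lam U) (ht : 0 ≤ t)
    (hδ : 0 < δ) (hδc : 16 * (h + 1) * δ ≤ c)
    (hW : IsCellFamily T θ b U (c * t / (16 * h)) W) {z : Fin h} (hz : Even (b z).val)
    {L : Finset (Fin h)} (hL : ∀ l ∈ L, ¬ Even (b l).val) {R : Fin n → Fin n → Prop}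
    (hR : R = T.adj ∨ R = fun x y => T.adj y x) :
    δ * X.card ≤ ((W z).filter fun x => ∀ l ∈ L, ∃ y ∈ W l, R x y).card := by
  have hh : (0 : ℝ) < h := by exact_mod_cast z.pos
  have hX : (0 : ℝ) ≤ X.card := by positivity
  have h1 := hU.card_le hδ.le ((hW.subset z).trans (hF.subset _)) (L := L) (W := W) ?_ hR
  · have h2 := hF.even _ hz
    have h3 : ((U (b z)).card : ℝ) ≤ 4 * (W z).card := by exact_mod_cast hW.even z hz
    have h4 : 16 * (h + 1) * δ * X.card ≤ c * X.card := by gcongr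
    nlinarith [mul_nonneg hh.le (mul_nonneg hδ.le hX), mul_nonneg hδ.le hX]
  · intro l hl
    refine ⟨(hW.subset l).trans (hF.subset _), (hW.odd l (hL l hl)).1,
      le_trans ?_ (hW.odd l (hL l hl)).2, ?_⟩
    · rw [le_div_iff₀ (by positivity)]
      have : 16 * (h + 1) * δ * t ≤ c * t := by gcongr
      nlinarith [mul_nonneg hδ.le ht]
    · refine (hF.disjoint fun he => ?_).mono (hW.subset z) (hW.subset l)
      exact hL l hl (he ▸ hz)

theorem IsCellFamily.realizes_star (hX : X.Nonempty) (hU : Unsplit T X δ t)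
    (hF : IsFrame T X t c lam U) (ht : 0 ≤ t) (hδ : 0 < δ) (hδc : 16 * (h + 1) * δ ≤ c)
    (hW : IsCellFamily T θ b U (c * t / (16 * h)) W) {Q : Finset (Fin h)} {z : Fin h}
    (hQ : H.IsFrontierStarAt θ Q z) (hz : Even (b z).val)
    (hL : ∀ l ∈ Q.erase z, ¬ Even (b l).val)
    (hb : ∀ u ∈ Q.erase z, ∀ v ∈ Q.erase z, b u = b v) : Realizes T H Q W := by
  have hleaf : ∀ u ∈ Q, ∀ v ∈ Q, u ≠ z → v ≠ z → H.adj u v → pos θ u < pos θ v := by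
    intro u hu v hv huz hvz huv
    by_contra hlt
    have hne : pos θ u ≠ pos θ v := fun he => by
      have : u = v := θ.symm.injective he
      exact adj_irrefl H v (this ▸ huv)
    have hB : H.Backward θ u v := ⟨huv, lt_of_le_of_ne (not_lt.1 hlt) hne.symm⟩
    rcases hQ with hQ | hQ
    · exact hvz (hQ.2.2.2 u hu v hv hB)
    · exact huz (hQ.2.2.2 u hu v hv hB)
  have key : ∀ R : Fin n → Fin n → Prop, (R = T.adj ∨ R = fun x y => T.adj y x) →
      ∃ x : Fin h → Fin n, x z ∈ W z ∧ ∀ l ∈ Q.erase z, x l ∈ W l ∧ R (x z) (x l) := by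
    intro R hR
    have h1 := hW.card_le hU hF ht hδ hδc hz hL hR
    have h2 : (0 : ℝ) < X.card := by exact_mod_cast hX.card_pos
    have h3 : (0 : ℝ) < ((W z).filter fun x => ∀ l ∈ Q.erase z, ∃ y ∈ W l, R x y).card :=
      lt_of_lt_of_le (by positivity) h1
    obtain ⟨x, hx⟩ := card_pos.1 (show 0 < _ by exact_mod_cast h3)
    obtain ⟨hxz, hx⟩ := mem_filter.1 hx
    have : Nonempty (Fin n) := ⟨x⟩
    choose! y hy using hx
    refine ⟨Function.update y z x, by simpa using hxz, fun l hl => ?_⟩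
    rw [Function.update_self, Function.update_of_ne (ne_of_mem_erase hl)]
    exact hy l hl
  have fin : ∀ x : Fin h → Fin n, x z ∈ W z → (∀ l ∈ Q.erase z, x l ∈ W l) →
      (∀ l ∈ Q.erase z, (H.adj z l → T.adj (x z) (x l)) ∧ (H.adj l z → T.adj (x l) (x z))) →
      Realizes T H Q W := by
    intro x hxz hxl hx
    have hmem : ∀ v ∈ Q, x v ∈ W v := fun v hv => by
      by_cases h : v = z
      · exact h ▸ hxz
      · exact hxl v (mem_erase.2 ⟨h, hv⟩)
    refine ⟨x, hmem, fun u hu v hv huv => ?_⟩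
    by_cases huz : u = z
    · subst huz
      have hvu : v ≠ u := by rintro rfl; exact adj_irrefl H _ huv
      exact (hx v (mem_erase.2 ⟨hvu, hv⟩)).1 huv
    · by_cases hvz : v = z
      · subst hvz
        exact (hx u (mem_erase.2 ⟨huz, hu⟩)).2 huv
      · exact hW.complete u v (hleaf u hu v hv huz hvz huv)
          (hb u (mem_erase.2 ⟨huz, hu⟩) v (mem_erase.2 ⟨hvz, hv⟩)) _ (hmem u hu) _ (hmem v hv)
  rcases hQ with hQ | hQ
  · obtain ⟨x, hxz, hx⟩ := key _ (Or.inr rfl)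
    exact fin x hxz (fun l hl => (hx l hl).1) fun l hl =>
      ⟨fun h => absurd h (H.asymm _ _ (hQ.2.2.1 l hl).2), fun _ => (hx l hl).2⟩
  · obtain ⟨x, hxz, hx⟩ := key _ (Or.inl rfl)
    exact fin x hxz (fun l hl => (hx l hl).1) fun l hl =>
      ⟨fun _ => (hx l hl).2, fun h => absurd h (H.asymm _ _ (hQ.2.2.1 l hl).2)⟩

theorem realizes_triangle {x y z : Fin h} (hT : H.IsTriangleAt θ x y z)
    (hex : ∃ s ∈ W x, ∃ u ∈ W y, ∃ v ∈ W z, T.adj u s ∧ T.adj v s ∧ T.adj v u) :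
    Realizes T H {x, y, z} W := by
  obtain ⟨s, hs, u, hu, v, hv, hus, hvs, hvu⟩ := hex
  obtain ⟨h1, h2, a1, a2, a3⟩ := hT
  have hyx : y ≠ x := by rintro rfl; exact lt_irrefl _ h1
  have hzy : z ≠ y := by rintro rfl; exact lt_irrefl _ h2
  have hzx : z ≠ x := by rintro rfl; exact lt_asymm h1 h2
  have b1 := H.asymm _ _ a1
  have b2 := H.asymm _ _ a2
  have b3 := H.asymm _ _ a3
  have i1 := adj_irrefl H x
  have i2 := adj_irrefl H y
  have i3 := adj_irrefl H z
  refine ⟨fun w => if w = x then s else if w = y then u else v, ?_, ?_⟩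
  · simp [hyx, hzy, hzx, hs, hu, hv]
  · intro p hp q hq
    simp only [mem_insert, mem_singleton] at hp hq
    rcases hp with rfl | rfl | rfl <;> rcases hq with rfl | rfl | rfl <;> simp_all

theorem IsCellFamily.realizes_super2Nebula (hX : X.Nonempty) (hA : Ample T X t)
    (hU : Unsplit T X δ t)
    (hF : IsFrame T X t c lam U) (ht : 0 ≤ t) (hδ : 0 < δ) (hδc : 16 * (h + 1) * δ ≤ c)
    (hW : IsCellFamily T θ b U (c * t / (16 * h)) W) {S L₁ L₂ : Finset (Fin h)} {c₁ c₂ : Fin h}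
    (hS : H.IsSuper2NebulaAt θ S c₁ c₂ L₁ L₂ NebKind.left) (hc₁ : Even (b c₁).val)
    (hc₂ : Even (b c₂).val) (hbc : b c₁ ≠ b c₂)
    (hL : ∀ l ∈ L₁ ∪ L₂, ¬ Even (b l).val)
    (hb : ∀ u ∈ L₁ ∪ L₂, ∀ v ∈ L₁ ∪ L₂, b u = b v)
    (hno : ∀ l ∈ L₁ ∪ L₂, ∀ s ∈ U (b l), ∀ u ∈ U (b c₁), ∀ v ∈ U (b c₂),
      ¬ (T.adj u s ∧ T.adj v s ∧ T.adj v u)) : Realizes T H S W := by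
  obtain ⟨⟨-, -, hL12, hc₁L, hc₂L, hc12, rfl, hc12'⟩, hpos, hL₁, hL₂, h21, hback⟩ := hS
  have hX0 : (0 : ℝ) < X.card := by exact_mod_cast hX.card_pos
  have hB := hW.card_le hU hF ht hδ hδc hc₁ (L := L₁)
    (fun l hl => hL l (mem_union_left _ hl)) (Or.inl rfl)
  have hC := hW.card_le hU hF ht hδ hδc hc₂ (L := L₂)
    (fun l hl => hL l (mem_union_right _ hl)) (Or.inl rfl)
  set B := (W c₁).filter fun x => ∀ l ∈ L₁, ∃ y ∈ W l, T.adj x y with hBdef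
  set C := (W c₂).filter fun x => ∀ l ∈ L₂, ∃ y ∈ W l, T.adj x y with hCdef
  have hBU : B ⊆ U (b c₁) := (filter_subset _ _).trans (hW.subset _)
  have hCU : C ⊆ U (b c₂) := (filter_subset _ _).trans (hW.subset _)
  have hBC : ∃ u ∈ B, ∃ v ∈ C, T.adj v u := by
    obtain ⟨S, hSC, hSt, hSc⟩ := hA.exists_trans ht hX (hCU.trans (hF.subset _)) hC
    have hd : Disjoint B C := (hF.disjoint hbc).mono hBU hCU
    have h1 := (hU B (hBU.trans (hF.subset _)) S (hSC.trans (hCU.trans (hF.subset _))) hB hSt hSc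
      (hd.mono_right hSC)).1
    push Not at h1
    obtain ⟨u, hu, v, hv, huv⟩ := h1
    refine ⟨u, hu, v, hSC hv, adj_of_not_adj ?_ huv⟩
    rintro rfl
    exact disjoint_left.1 hd hu (hSC hv)
  obtain ⟨u, hu, v, hv, hvu⟩ := hBC
  obtain ⟨huW, hu1⟩ := mem_filter.1 hu
  obtain ⟨hvW, hv1⟩ := mem_filter.1 hv
  have : Nonempty (Fin n) := ⟨u⟩
  choose! y₁ hy₁ using hu1
  choose! y₂ hy₂ using hv1
  have hUW : ∀ l ∈ L₁ ∪ L₂, ∀ s ∈ W l, ∀ w, Even (b w).val → ∀ x ∈ W w, x ≠ s := by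
    intro l hl s hs w hw x hx
    rintro rfl
    exact disjoint_left.1 (hF.disjoint fun he : b w = b l => hL l hl (he ▸ hw)) (hW.subset _ hx)
      (hW.subset _ hs)
  have hy₁' : ∀ l ∈ L₁, T.adj (y₁ l) v := fun l hl => by
    have hl' := mem_union_left L₂ hl
    refine adj_of_not_adj (hUW l hl' _ (hy₁ l hl).1 c₂ hc₂ v hvW) fun hvs => ?_
    exact hno l hl' _ (hW.subset _ (hy₁ l hl).1) u (hBU hu) v (hCU hv) ⟨(hy₁ l hl).2, hvs, hvu⟩
  have hy₂' : ∀ l ∈ L₂, T.adj (y₂ l) u := fun l hl => by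
    have hl' := mem_union_right L₁ hl
    refine adj_of_not_adj (hUW l hl' _ (hy₂ l hl).1 c₁ hc₁ u huW) fun hus => ?_
    exact hno l hl' _ (hW.subset _ (hy₂ l hl).1) u (hBU hu) v (hCU hv) ⟨hus, (hy₂ l hl).2, hvu⟩
  let x : Fin h → Fin n := fun w =>
    if w = c₁ then u else if w = c₂ then v else if w ∈ L₁ then y₁ w else y₂ w
  have hxc₁ : x c₁ = u := by simp [x]
  have hxc₂ : x c₂ = v := by simp [x, hc12.symm]
  have hx₁ : ∀ l ∈ L₁, x l = y₁ l := fun l hl => by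
    have h1 : l ≠ c₁ := by rintro rfl; exact hc₁L (mem_union_left _ hl)
    have h2 : l ≠ c₂ := by rintro rfl; exact hc₂L (mem_union_left _ hl)
    simp [x, h1, h2, hl]
  have hx₂ : ∀ l ∈ L₂, x l = y₂ l := fun l hl => by
    have h1 : l ≠ c₁ := by rintro rfl; exact hc₁L (mem_union_right _ hl)
    have h2 : l ≠ c₂ := by rintro rfl; exact hc₂L (mem_union_right _ hl)
    have h3 : l ∉ L₁ := fun h => disjoint_left.1 hL12 h hl
    simp [x, h1, h2, h3]
  have hxL : ∀ l ∈ L₁ ∪ L₂, x l ∈ W l := fun l hl => by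
    rcases mem_union.1 hl with h | h
    · rw [hx₁ l h]; exact (hy₁ l h).1
    · rw [hx₂ l h]; exact (hy₂ l h).1
  have hcl : ∀ l ∈ L₁ ∪ L₂, (H.adj c₁ l → T.adj (x c₁) (x l)) ∧ (H.adj l c₁ → T.adj (x l) (x c₁)) ∧
      (H.adj c₂ l → T.adj (x c₂) (x l)) ∧ (H.adj l c₂ → T.adj (x l) (x c₂)) := by
    intro l hl
    have hlS : l ∈ insert c₁ (insert c₂ (L₁ ∪ L₂)) := by simp [hl]
    have hlc₁ : l ≠ c₁ := by rintro rfl; exact hc₁L hl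
    have hno2 : H.adj c₂ l → l ∈ L₂ := fun ha => by
      have := hback c₂ (by simp) l hlS ⟨ha, (hpos l hl).trans hc12'⟩
      simpa [hc12.symm, hlc₁] using this
    have hno1 : H.adj c₁ l → l ∈ L₁ := fun ha => by
      have := hback c₁ (by simp) l hlS ⟨ha, hpos l hl⟩
      simpa [hc12, hlc₁] using this
    rw [hxc₁, hxc₂]
    rcases mem_union.1 hl with h1 | h2
    · rw [hx₁ l h1]
      exact ⟨fun _ => (hy₁ l h1).2, fun ha => absurd ha (H.asymm _ _ (hL₁ l h1)),
        fun ha => absurd (hno2 ha) (disjoint_left.1 hL12 h1), fun _ => hy₁' l h1⟩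
    · rw [hx₂ l h2]
      exact ⟨fun ha => absurd h2 (disjoint_left.1 hL12 (hno1 ha)), fun _ => hy₂' l h2,
        fun _ => (hy₂ l h2).2, fun ha => absurd ha (H.asymm _ _ (hL₂ l h2))⟩
  have hll : ∀ k ∈ L₁ ∪ L₂, ∀ l ∈ L₁ ∪ L₂, H.adj k l → T.adj (x k) (x l) := by
    intro k hk l hl hkl
    have hkc₁ : k ≠ c₁ := by rintro rfl; exact hc₁L hk
    have hkc₂ : k ≠ c₂ := by rintro rfl; exact hc₂L hk
    refine hW.complete k l ?_ (hb k hk l hl) _ (hxL k hk) _ (hxL l hl)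
    by_contra hlt
    have hne : pos θ k ≠ pos θ l := fun he => by
      have : k = l := θ.symm.injective he
      exact adj_irrefl H l (this ▸ hkl)
    have := hback k (by simp [hk]) l (by simp [hl]) ⟨hkl, lt_of_le_of_ne (not_lt.1 hlt) hne.symm⟩
    simp [hkc₁, hkc₂] at this
  refine ⟨x, ?_, ?_⟩
  · intro w hw
    rcases mem_insert.1 hw with rfl | hw
    · rwa [hxc₁]
    rcases mem_insert.1 hw with rfl | hw
    · rwa [hxc₂]
    exact hxL w hw
  · intro p hp q hq hpq
    have i1 := adj_irrefl H c₁
    have i2 := adj_irrefl H c₂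
    have i3 := H.asymm _ _ h21
    rcases mem_insert.1 hp with rfl | hp₁
    · rcases mem_insert.1 hq with rfl | hq
      · exact absurd hpq i1
      rcases mem_insert.1 hq with rfl | hq
      · exact absurd hpq i3
      exact (hcl q hq).1 hpq
    rcases mem_insert.1 hp₁ with rfl | hp₂
    · rcases mem_insert.1 hq with rfl | hq
      · rwa [hxc₁, hxc₂]
      rcases mem_insert.1 hq with rfl | hq
      · exact absurd hpq i2
      exact (hcl q hq).2.2.1 hpq
    rcases mem_insert.1 hq with rfl | hq
    · exact (hcl p hp₂).2.1 hpq
    rcases mem_insert.1 hq with rfl | hq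
    · exact (hcl p hp₂).2.2.2 hpq
    exact hll p hp₂ q hq hpq

end Cells

end Frames

section Block

variable {h : ℕ}

/-- The block of a vertex: the vertices of `Z` get pairwise different even indices, the vertices
strictly between two consecutive vertices of `Z` share an odd index. -/
noncomputable def block (θ : Equiv.Perm (Fin h)) (Z : Finset (Fin h)) (v : Fin h) :
    Fin (2 * h + 2) :=
  ⟨2 * (Z.filter fun w => pos θ w ≤ pos θ v).card + if v ∈ Z then 0 else 1, by
    have h1 : (Z.filter fun w => pos θ w ≤ pos θ v).card ≤ h := by
      simpa using card_le_univ (Z.filter fun w => pos θ w ≤ pos θ v)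
    split_ifs <;> omega⟩

variable {θ : Equiv.Perm (Fin h)} {Z : Finset (Fin h)} {u v : Fin h}

theorem even_block : Even (block θ Z v).val ↔ v ∈ Z := by
  by_cases hv : v ∈ Z <;> simp [block, hv]

theorem block_lt_or (huv : pos θ u < pos θ v) :
    block θ Z u < block θ Z v ∨ (block θ Z u = block θ Z v ∧ ¬ Even (block θ Z u).val) := by
  have h1 : (Z.filter fun w => pos θ w ≤ pos θ u) ⊆ Z.filter fun w => pos θ w ≤ pos θ v :=
    monotone_filter_right _ fun w _ hw => hw.trans huv.le
  have h2 := card_le_card h1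
  rw [Fin.lt_def, Fin.ext_iff, even_block]
  by_cases hv : v ∈ Z
  · have h3 := card_lt_card (Finset.ssubset_iff_subset_ne.2 ⟨h1, fun he => by
      have : v ∈ Z.filter fun w => pos θ w ≤ pos θ u := he ▸ mem_filter.2 ⟨hv, le_rfl⟩
      exact absurd (mem_filter.1 this).2 (not_le.2 huv)⟩)
    left
    simp only [block, hv, if_true]
    split_ifs <;> omega
  · by_cases hu : u ∈ Z
    · left
      simp only [block, hv, hu, if_true, if_false]
      omega
    · simp only [block, hv, hu, if_false]
      simp only [not_false_eq_true, and_true]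
      omega

theorem block_lt_of_mem (huv : pos θ u < pos θ v) (h : u ∈ Z ∨ v ∈ Z) :
    block θ Z u < block θ Z v := by
  refine (block_lt_or huv).resolve_right fun ⟨h1, h2⟩ => ?_
  have h3 := h1 ▸ h2
  rw [even_block] at h2 h3
  tauto

theorem block_eq {L : Finset (Fin h)} (hL : Disjoint L Z) (hb : ∀ z ∈ Z, ¬ BetweenSet θ L z)
    (hu : u ∈ L) (hv : v ∈ L) : block θ Z u = block θ Z v := by
  have huZ : u ∉ Z := disjoint_left.1 hL hu
  have hvZ : v ∉ Z := disjoint_left.1 hL hv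
  have key : ∀ u ∈ L, ∀ v ∈ L, ∀ z ∈ Z, pos θ z ≤ pos θ u → pos θ z ≤ pos θ v := by
    intro u hu v hv z hz hzu
    by_contra hlt
    refine hb z hz ⟨v, hv, u, hu, not_le.1 hlt, lt_of_le_of_ne hzu fun he => ?_⟩
    have : z = u := θ.symm.injective he
    exact disjoint_left.1 hL hu (this ▸ hz)
  have : (Z.filter fun w => pos θ w ≤ pos θ u) = Z.filter fun w => pos θ w ≤ pos θ v :=
    filter_congr fun z hz => ⟨key u hu v hv z hz, key v hv u hu z hz⟩
  simp [block, huZ, hvZ, this]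

end Block

theorem IsFrontierStarAt.center_not_between {h : ℕ} {H : Tournament h} {θ : Equiv.Perm (Fin h)}
    {Q : Finset (Fin h)} {z : Fin h} (hQ : H.IsFrontierStarAt θ Q z) :
    ¬ BetweenSet θ (Q.erase z) z := by
  rintro ⟨u, hu, w, hw, huz, hzw⟩
  rcases hQ with hQ | hQ
  · exact lt_asymm huz (hQ.2.2.1 u hu).1
  · exact lt_asymm hzw (hQ.2.2.1 w hw).1

theorem IsFrontierStarAt.center_mem {h : ℕ} {H : Tournament h} {θ : Equiv.Perm (Fin h)}
    {Q : Finset (Fin h)} {z : Fin h} (hQ : H.IsFrontierStarAt θ Q z) : z ∈ Q := by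
  rcases hQ with hQ | hQ <;> exact hQ.1

theorem exists_threshold_triangularGalaxy {h : ℕ} {H : Tournament h}
    (hH : H.IsLeftTriangularGalaxy) : ∃ lam : ℝ, 0 < lam ∧
    ∀ {n : ℕ} {T : Tournament n} {X : Finset (Fin n)} {t c δ : ℝ}
      {U : Fin (2 * h + 2) → Finset (Fin n)},
      X.Nonempty → Ample T X t → Unsplit T X δ t → 0 ≤ t → 0 < δ → 16 * (h + 1) * δ ≤ c →
      2 * h ≤ c * t → IsFrame T X t c lam U →
      (∀ i j k, i < j → j < k → ∀ S ⊆ U i, ∀ B ⊆ U j, ∀ C ⊆ U k, T.IsTransOn S →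
        c * t / (16 * h) ≤ S.card → (U j).card ≤ 4 * B.card → (U k).card ≤ 4 * C.card →
        ∃ s ∈ S, ∃ u ∈ B, ∃ v ∈ C, T.adj u s ∧ T.adj v s ∧ T.adj v u) →
      T.Contains H := by
  obtain ⟨θ, l, k, A, B, C, Q, ctr, hTri, hQ, hTT, hTQ, hQQ, hback, hcc, hforb⟩ := hH
  obtain ⟨lam, hlam, key⟩ := exists_sparsity_threshold h (2 * h + 2)
  refine ⟨lam, hlam, ?_⟩
  intro n T X t c δ U hX hA hU ht hδ hδc hct hF htri
  let tri : Fin l → Finset (Fin h) := fun i => {A i, B i, C i}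
  let Z : Finset (Fin h) := univ.image ctr ∪ (univ.image B ∪ univ.image C)
  let G : (Fin l ⊕ Fin k) ⊕ {v : Fin h // (∀ i, v ∉ tri i) ∧ ∀ j, v ∉ Q j} → Finset (Fin h) :=
    Sum.elim (Sum.elim tri Q) fun v => {v.1}
  have hG : IsGadgetDecomp H θ G := by
    refine ⟨fun v => ?_, ?_, fun u v huv => ?_⟩
    · by_cases h1 : ∃ i, v ∈ tri i
      · obtain ⟨i, hi⟩ := h1
        exact ⟨Sum.inl (Sum.inl i), hi⟩
      by_cases h2 : ∃ j, v ∈ Q j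
      · obtain ⟨j, hj⟩ := h2
        exact ⟨Sum.inl (Sum.inr j), hj⟩
      · push Not at h1 h2
        exact ⟨Sum.inr ⟨v, h1, h2⟩, by simp [G]⟩
    · rintro ((i | i) | v) ((j | j) | w) hne
      · exact hTT i j (by rintro rfl; exact hne rfl)
      · exact hTQ i j
      · exact disjoint_singleton_right.2 (w.2.1 i)
      · exact (hTQ j i).symm
      · exact hQQ i j (by rintro rfl; exact hne rfl)
      · exact disjoint_singleton_right.2 (w.2.2 i)
      · exact disjoint_singleton_left.2 (v.2.1 j)
      · exact disjoint_singleton_left.2 (v.2.2 j)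
      · refine disjoint_singleton.2 fun he => hne ?_
        rw [Subtype.ext he]
    · rcases hback u v huv with ⟨i, hi⟩ | ⟨j, hj⟩
      · exact ⟨Sum.inl (Sum.inl i), hi⟩
      · exact ⟨Sum.inl (Sum.inr j), hj⟩
  have hBZ : ∀ i, B i ∈ Z := fun i => by simp [Z]
  have hCZ : ∀ i, C i ∈ Z := fun i => by simp [Z]
  have hcZ : ∀ j, ctr j ∈ Z := fun j => by simp [Z]
  have hAZ : ∀ i, A i ∉ Z := by
    intro i hi
    have hAi : A i ∈ tri i := by simp [tri]
    have hT := hTri i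
    simp only [Z, mem_union, mem_image, mem_univ, true_and] at hi
    rcases hi with ⟨j, hj⟩ | ⟨j, hj⟩ | ⟨j, hj⟩
    · exact disjoint_left.1 (hTQ i j) hAi (hj ▸ IsFrontierStarAt.center_mem (hQ j))
    · have : i = j := by
        by_contra hne
        exact disjoint_left.1 (hTT i j hne) hAi (by simp [hj])
      subst this
      exact hT.1.ne (by rw [hj])
    · have : i = j := by
        by_contra hne
        exact disjoint_left.1 (hTT i j hne) hAi (by simp [hj])
      subst this
      exact (hT.1.trans hT.2.1).ne (by rw [hj])
  have hQZ : ∀ j, Disjoint ((Q j).erase (ctr j)) Z := by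
    intro j
    refine disjoint_left.2 fun v hv hvZ => ?_
    have hvQ := mem_of_mem_erase hv
    simp only [Z, mem_union, mem_image, mem_univ, true_and] at hvZ
    rcases hvZ with ⟨i, hi⟩ | ⟨i, hi⟩ | ⟨i, hi⟩
    · have : i = j := by
        by_contra hne
        exact disjoint_left.1 (hQQ i j hne) (IsFrontierStarAt.center_mem (hQ i)) (hi ▸ hvQ)
      subst this
      exact ne_of_mem_erase hv hi.symm
    · exact disjoint_left.1 (hTQ i j) (by simp [hi]) hvQ
    · exact disjoint_left.1 (hTQ i j) (by simp [hi]) hvQ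
  have hZb : ∀ j, ∀ z ∈ Z, ¬ BetweenSet θ ((Q j).erase (ctr j)) z := by
    intro j z hz
    simp only [Z, mem_union, mem_image, mem_univ, true_and] at hz
    rcases hz with ⟨i, rfl⟩ | ⟨i, rfl⟩ | ⟨i, rfl⟩
    · by_cases hij : i = j
      · subst hij
        exact IsFrontierStarAt.center_not_between (hQ i)
      · exact hcc i j hij
    · exact hforb i j _ (by simp)
    · exact hforb i j _ (by simp)
  refine key (b := block θ Z) hG (fun u v huv => block_lt_or huv) hX hA ht ?_ hct hF.subset
    hF.sparse hF.odd ?_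
  · exact lt_of_lt_of_le (by positivity) hδc
  rintro ((i | j) | w) W hW
  · refine realizes_triangle (hTri i) ?_
    refine htri (block θ Z (A i)) (block θ Z (B i)) (block θ Z (C i))
      (block_lt_of_mem (hTri i).1 (Or.inr (hBZ i))) (block_lt_of_mem (hTri i).2.1 (Or.inr (hCZ i)))
      _ (hW.subset _) _ (hW.subset _) _ (hW.subset _) ?_ ?_ (hW.even _ (even_block.2 (hBZ i)))
      (hW.even _ (even_block.2 (hCZ i)))
    · exact (hW.odd _ (even_block.not.2 (hAZ i))).1
    · exact (hW.odd _ (even_block.not.2 (hAZ i))).2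
  · exact hW.realizes_star hX hU hF ht hδ hδc (hQ j) (even_block.2 (hcZ j))
      (fun l hl => even_block.not.2 (disjoint_left.1 (hQZ j) hl))
      (fun u hu v hv => block_eq (hQZ j) (hZb j) hu hv)
  · have hwZ : w.1 ∉ Z := by
      intro hw
      simp only [Z, mem_union, mem_image, mem_univ, true_and] at hw
      rcases hw with ⟨j, hj⟩ | ⟨i, hi⟩ | ⟨i, hi⟩
      · exact w.2.2 j (hj ▸ IsFrontierStarAt.center_mem (hQ j))
      · exact w.2.1 i (by simp [tri, hi])
      · exact w.2.1 i (by simp [tri, hi])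
    have hh : (0 : ℝ) < h := by exact_mod_cast w.1.pos
    have h1 : (0 : ℝ) < (W w.1).card :=
      lt_of_lt_of_le (by have : 0 < c * t := by linarith
                         positivity) (hW.odd _ (even_block.not.2 hwZ)).2
    obtain ⟨x, hx⟩ := card_pos.1 (show 0 < (W w.1).card by exact_mod_cast h1)
    refine ⟨fun _ => x, fun v hv => ?_, fun u hu v hv huv => ?_⟩
    · rw [mem_singleton.1 hv]
      exact hx
    · rw [mem_singleton.1 hu, mem_singleton.1 hv] at huv
      exact absurd huv (adj_irrefl H _)

theorem exists_threshold_sigmaGalaxy {h : ℕ} {H : Tournament h}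
    (hH : H.IsLeftSigmaGalaxy) : ∃ lam : ℝ, 0 < lam ∧ ∃ p q r : Fin (2 * h + 2), p < q ∧ q < r ∧
    ¬ Even p.val ∧ Even q.val ∧ Even r.val ∧
    ∀ {n : ℕ} {T : Tournament n} {X : Finset (Fin n)} {t c δ : ℝ}
      {U : Fin (2 * h + 2) → Finset (Fin n)},
      X.Nonempty → Ample T X t → Unsplit T X δ t → 0 ≤ t → 0 < δ → 16 * (h + 1) * δ ≤ c →
      2 * h ≤ c * t → IsFrame T X t c lam U →
      (∀ s ∈ U p, ∀ u ∈ U q, ∀ v ∈ U r, ¬ (T.adj u s ∧ T.adj v s ∧ T.adj v u)) →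
      T.Contains H := by
  obtain ⟨θ, S, c₁, c₂, L₁, L₂, m, Q, ctr, hS, hQ, hQQ, hSQ, hcov, hback, hcL, hcQ, hcc⟩ := hH
  obtain ⟨lam, hlam, key⟩ := exists_sparsity_threshold h (2 * h + 2)
  obtain ⟨⟨⟨l₀, hl₀⟩, -, -, hc₁L, hc₂L, hc12, hSeq, hc12'⟩, hpos, -⟩ := id hS
  let Z : Finset (Fin h) := univ.image ctr ∪ {c₁, c₂}
  have hc₁Z : c₁ ∈ Z := by simp [Z]
  have hc₂Z : c₂ ∈ Z := by simp [Z]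
  have hcZ : ∀ j, ctr j ∈ Z := fun j => by simp [Z]
  have hc₁S : c₁ ∈ S := by simp [hSeq]
  have hc₂S : c₂ ∈ S := by simp [hSeq]
  have hLS : ∀ l ∈ L₁ ∪ L₂, l ∈ S := fun l hl => by
    rw [hSeq]; exact mem_insert_of_mem (mem_insert_of_mem hl)
  have hLZ : Disjoint (L₁ ∪ L₂) Z := by
    refine disjoint_left.2 fun v hv hvZ => ?_
    simp only [Z, mem_union, mem_image, mem_univ, true_and, mem_insert, mem_singleton] at hvZ
    rcases hvZ with ⟨j, hj⟩ | rfl | rfl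
    · exact disjoint_left.1 (hSQ j) (hLS v hv) (hj ▸ IsFrontierStarAt.center_mem (hQ j))
    · exact hc₁L hv
    · exact hc₂L hv
  have hZL : ∀ z ∈ Z, ¬ BetweenSet θ (L₁ ∪ L₂) z := by
    intro z hz
    simp only [Z, mem_union, mem_image, mem_univ, true_and, mem_insert, mem_singleton] at hz
    rcases hz with ⟨j, rfl⟩ | rfl | rfl
    · exact hcL j
    · rintro ⟨-, -, w, hw, -, hzw⟩
      exact lt_asymm hzw (hpos w hw)
    · rintro ⟨-, -, w, hw, -, hzw⟩
      exact lt_asymm hzw ((hpos w hw).trans hc12')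
  have hQZ : ∀ j, Disjoint ((Q j).erase (ctr j)) Z := by
    intro j
    refine disjoint_left.2 fun v hv hvZ => ?_
    have hvQ := mem_of_mem_erase hv
    simp only [Z, mem_union, mem_image, mem_univ, true_and, mem_insert, mem_singleton] at hvZ
    rcases hvZ with ⟨i, hi⟩ | rfl | rfl
    · have : i = j := by
        by_contra hne
        exact disjoint_left.1 (hQQ i j hne) (IsFrontierStarAt.center_mem (hQ i)) (hi ▸ hvQ)
      subst this
      exact ne_of_mem_erase hv hi.symm
    · exact disjoint_left.1 (hSQ j) hc₁S hvQ
    · exact disjoint_left.1 (hSQ j) hc₂S hvQ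
  have hZb : ∀ j, ∀ z ∈ Z, ¬ BetweenSet θ ((Q j).erase (ctr j)) z := by
    intro j z hz
    simp only [Z, mem_union, mem_image, mem_univ, true_and, mem_insert, mem_singleton] at hz
    rcases hz with ⟨i, rfl⟩ | rfl | rfl
    · by_cases hij : i = j
      · subst hij
        exact IsFrontierStarAt.center_not_between (hQ i)
      · exact hcc i j hij
    · exact (hcQ j).1
    · exact (hcQ j).2
  let G : Option (Fin m) → Finset (Fin h) := fun o => o.elim S Q
  have hG : IsGadgetDecomp H θ G := by
    refine ⟨fun v => ?_, ?_, fun u v huv => ?_⟩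
    · rcases hcov v with hv | ⟨j, hj⟩
      · exact ⟨none, hv⟩
      · exact ⟨some j, hj⟩
    · rintro (_ | i) (_ | j) hne
      · exact absurd rfl hne
      · exact hSQ j
      · exact (hSQ i).symm
      · exact hQQ i j (by rintro rfl; exact hne rfl)
    · rcases hback u v huv with hv | ⟨j, hj⟩
      · exact ⟨none, hv⟩
      · exact ⟨some j, hj⟩
  have hl₀' : l₀ ∈ L₁ ∪ L₂ := mem_union_left _ hl₀
  have hbL : ∀ u ∈ L₁ ∪ L₂, ∀ v ∈ L₁ ∪ L₂, block θ Z u = block θ Z v :=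
    fun u hu v hv => block_eq hLZ hZL hu hv
  refine ⟨lam, hlam, block θ Z l₀, block θ Z c₁, block θ Z c₂,
    block_lt_of_mem (hpos l₀ hl₀') (Or.inr hc₁Z), block_lt_of_mem hc12' (Or.inr hc₂Z),
    even_block.not.2 (disjoint_left.1 hLZ hl₀'), even_block.2 hc₁Z, even_block.2 hc₂Z, ?_⟩
  intro n T X t c δ U hX hA hU ht hδ hδc hct hF hno
  refine key (b := block θ Z) hG (fun u v huv => block_lt_or huv) hX hA ht ?_ hct hF.subset
    hF.sparse hF.odd ?_
  · exact lt_of_lt_of_le (by positivity) hδc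
  rintro (_ | j) W hW
  · exact hW.realizes_super2Nebula hX hA hU hF ht hδ hδc hS (even_block.2 hc₁Z)
      (even_block.2 hc₂Z) (block_lt_of_mem hc12' (Or.inr hc₂Z)).ne
      (fun l hl => even_block.not.2 (disjoint_left.1 hLZ hl)) hbL
      (fun l hl => hbL l₀ hl₀' l hl ▸ hno)
  · exact hW.realizes_star hX hU hF ht hδ hδc (hQ j) (even_block.2 (hcZ j))
      (fun l hl => even_block.not.2 (disjoint_left.1 (hQZ j) hl))
      (fun u hu v hv => block_eq (hQZ j) (hZb j) hu hv)

theorem exists_increasing_through {g M a b c : ℕ} {p q r : Fin g} (hpq : p < q) (hqr : q < r)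
    (ha : g ≤ a) (hab : a + g ≤ b) (hbc : b + g ≤ c) (hc : c + g ≤ M) :
    ∃ f : Fin g → Fin M, (∀ x y, x < y → f x < f y) ∧ (f p).val = a ∧ (f q).val = b ∧
      (f r).val = c := by
  refine ⟨fun x => if x < q then ⟨a + x.val - p.val, by omega⟩
    else if x < r then ⟨b + x.val - q.val, by omega⟩ else ⟨c + x.val - r.val, by omega⟩, ?_, ?_⟩
  · intro x y hxy
    simp only [Fin.lt_def] at *
    split_ifs <;> dsimp only <;> omega
  · simp [hpq, hqr, hqr.not_gt]

/-- In a smooth family of large sets, one set can be replaced by a transitive subset and two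
others by large subsets. -/
theorem exists_frame_of_smooth {n : ℕ} {T : Tournament n} {X : Finset (Fin n)} {t c c' lam mu : ℝ}
    {g : ℕ} {V : Fin g → Finset (Fin n)} {p q r : Fin g} {S B C : Finset (Fin n)} (hpq : p < q)
    (hqr : q < r) (hp : ¬ Even p.val) (hVX : ∀ i, V i ⊆ X)
    (hVd : ∀ i j, i < j → Disjoint (V i) (V j)) (hlam : 0 ≤ lam) (hmu : 4 * lam ≤ mu)
    (hVs : ∀ i j, i < j → Smooth T lam (V i) (V j)) (hc : 4 * c' ≤ c)
    (hVc : ∀ i, c * X.card ≤ (V i).card) (hS : S ⊆ V p) (hB : B ⊆ V q) (hC : C ⊆ V r)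
    (hSt : T.IsTransOn S) (hSc : c' * t ≤ S.card) (hBc : (V q).card ≤ 4 * B.card)
    (hCc : (V r).card ≤ 4 * C.card) :
    ∃ W : Fin g → Finset (Fin n), W p = S ∧ W q = B ∧ W r = C ∧ IsFrame T X t c' mu W := by
  let W : Fin g → Finset (Fin n) := fun x =>
    if x = p then S else if x = q then B else if x = r then C else V x
  have hWp : W p = S := by simp [W]
  have hWq : W q = B := by simp [W, hpq.ne']
  have hWr : W r = C := by simp [W, hqr.ne', (hpq.trans hqr).ne']
  have hWV : ∀ x, W x ⊆ V x := by
    intro x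
    by_cases hxp : x = p
    · rw [hxp, hWp]; exact hS
    by_cases hxq : x = q
    · rw [hxq, hWq]; exact hB
    by_cases hxr : x = r
    · rw [hxr, hWr]; exact hC
    · simp [W, hxp, hxq, hxr]
  have hWc : ∀ x, x ≠ p → (V x).card ≤ 4 * (W x).card := by
    intro x hxp
    by_cases hxq : x = q
    · rw [hxq, hWq]; exact hBc
    by_cases hxr : x = r
    · rw [hxr, hWr]; exact hCc
    · simp only [W, hxp, hxq, hxr, if_false]
      omega
  have hWX : ∀ x, x ≠ p → c' * X.card ≤ (W x).card := by
    intro x hx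
    have h4 : ((V x).card : ℝ) ≤ 4 * (W x).card := by exact_mod_cast hWc x hx
    have h5 := hVc x
    have h6 : 4 * c' * X.card ≤ c * X.card := by gcongr
    linarith
  refine ⟨W, hWp, hWq, hWr, fun x => (hWV x).trans (hVX _),
    fun x y hxy => (hVd _ _ hxy).mono (hWV x) (hWV y), fun x y hxy => ?_,
    fun x hx => hWX x (by rintro rfl; exact hp hx), fun x _ => ?_⟩
  · refine Sparse.mono ((hVs _ _ hxy).sparse_subset (k := 4) hlam (hWV x) (hWV y) ?_) hmu
    by_cases hx : x = p
    · right
      exact_mod_cast hWc y (fun hy => hxy.ne (hx.trans hy.symm))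
    · left
      exact_mod_cast hWc x hx
  · by_cases hx : x = p
    · right
      rw [hx, hWp]
      exact ⟨hSt, hSc⟩
    · exact Or.inl (hWX x hx)

theorem exists_unsplit_threshold {h₁ h₂ : ℕ} {H₁ : Tournament h₁} {H₂ : Tournament h₂}
    (hH₁ : H₁.IsLeftSigmaGalaxy) (hH₂ : H₂.IsLeftTriangularGalaxy) :
    ∃ δ : ℝ, 0 < δ ∧ ∃ N : ℕ, ∀ {n : ℕ} {T : Tournament n} {X : Finset (Fin n)} {t : ℝ},
      N ≤ X.card → (N : ℝ) ≤ t → Ample T X t → Unsplit T X δ t →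
      T.Contains H₁ ∨ T.Contains H₂ := by
  obtain ⟨lam₁, hlam₁, hkey₁⟩ := exists_threshold_sigmaGalaxy hH₁
  have hg0 : 0 < 2 * h₁ + 2 := by omega
  generalize 2 * h₁ + 2 = g at hkey₁ hg0
  obtain ⟨p, q, r, hpq, hqr, hp, hq, hr, key₁⟩ := hkey₁
  obtain ⟨lam₂, hlam₂, key₂⟩ := exists_threshold_triangularGalaxy hH₂
  set M := g * (2 * h₂ + 2 + 2) with hM
  have hM0 : 0 < M := by positivity
  have hM0' : (0 : ℝ) < M := by exact_mod_cast hM0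
  set lam := min lam₂ (lam₁ / 4) with hlam
  have hlam0 : 0 < lam := by positivity
  have hlam2 : lam ≤ lam₂ := min_le_left _ _
  have hlam1 : 4 * lam ≤ lam₁ := by
    have : lam ≤ lam₁ / 4 := min_le_right _ _
    linarith
  obtain ⟨c₀, hc₀, hc₀1, m, hfam⟩ :=
    exists_sparse_family H₁ M (show 0 < lam / (4 * M) by positivity)
  set c := c₀ / 2 with hc
  have hc0 : 0 < c := by positivity
  set c₁ := c / (16 * (h₂ + 1)) with hc₁
  have hc₁0 : 0 < c₁ := by positivity
  have hc₁c : 16 * c₁ ≤ c := by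
    rw [hc₁, mul_div_assoc', div_le_iff₀ (by positivity)]
    nlinarith [(Nat.cast_nonneg h₂ : (0 : ℝ) ≤ h₂)]
  set δ := c₁ / (16 * (h₁ + h₂ + 1)) with hδ
  have hδ0 : 0 < δ := by positivity
  have hδ' : 16 * (h₁ + h₂ + 1) * δ = c₁ := by
    rw [hδ]; field_simp
  have hh₁ : (0 : ℝ) ≤ h₁ := by positivity
  have hh₂ : (0 : ℝ) ≤ h₂ := by positivity
  have hδ1 : 16 * (h₁ + 1) * δ ≤ c₁ := by nlinarith [mul_nonneg hh₂ hδ0.le]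
  have hδ2 : 16 * (h₂ + 1) * δ ≤ c := by nlinarith [mul_nonneg hh₁ hδ0.le]
  refine ⟨δ, hδ0, max m ⌈(2 * (h₁ + h₂) + 1) / c₁⌉₊, ?_⟩
  intro n T X t hXN htN hA hU
  have hm : m ≤ X.card := (le_max_left _ _).trans hXN
  have hbig : ∀ s : ℝ, ((max m ⌈(2 * (h₁ + h₂) + 1) / c₁⌉₊ : ℕ) : ℝ) ≤ s →
      2 * (h₁ + h₂) + 1 ≤ c₁ * s := by
    intro s hs
    rw [← div_le_iff₀' hc₁0]
    exact (Nat.le_ceil _).trans (le_trans (Nat.cast_le.2 (le_max_right _ _)) hs)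
  have ht := hbig t htN
  have ht0 : 0 ≤ t := le_trans (Nat.cast_nonneg _) htN
  have hX : X.Nonempty := by
    have := hbig X.card (by exact_mod_cast hXN)
    rw [← card_pos]
    by_contra h0
    have : X.card = 0 := by omega
    simp [this] at *
    linarith
  by_contra! hcon
  obtain ⟨hcon₁, hcon₂⟩ := hcon
  have hh₂0 : 0 < h₂ := by
    by_contra h0
    obtain rfl : h₂ = 0 := by omega
    exact hcon₂ (contains_of_adj (fun i => i.elim0) fun i => i.elim0)
  obtain ⟨U, hUX, hUs⟩ := hfam n T X hcon₁ hm
  obtain ⟨V, hVU, hVc, hVs⟩ := exists_smooth_subfamily (ord := fun i : Fin M => i.val) (U := U)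
    (show 0 < lam / (4 * M) by positivity) (fun i j hij => (hUs i j hij).2)
  have hlamM : 4 * (Fintype.card (Fin M) : ℝ) * (lam / (4 * M)) = lam := by
    rw [Fintype.card_fin]; field_simp
  rw [hlamM] at hVs
  have hVX : ∀ i, V i ⊆ X := fun i => (hVU i).trans (hUX i).1
  have hVcX : ∀ i, c * X.card ≤ (V i).card := fun i => by
    have h1 := (hUX i).2
    have h2 : ((U i).card : ℝ) ≤ 2 * (V i).card := by exact_mod_cast hVc i
    rw [hc]; linarith
  have hVd : ∀ i j, i < j → Disjoint (V i) (V j) := fun i j hij =>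
    (hUs i j hij).1.mono (hVU i) (hVU j)
  have hgM : ∀ i : Fin (2 * h₂ + 2), g * (i.val + 1) + g ≤ g * (2 * h₂ + 2 + 1) := fun i => by
    have := i.isLt
    calc g * (i.val + 1) + g = g * (i.val + 2) := by ring
      _ ≤ _ := Nat.mul_le_mul_left _ (by omega)
  have hgM' : g * (2 * h₂ + 2 + 1) + g = M := by rw [hM]; ring
  have hgij : ∀ i j : Fin (2 * h₂ + 2), i < j → g * (i.val + 1) + g ≤ g * (j.val + 1) :=
    fun i j hij => by
      calc g * (i.val + 1) + g = g * (i.val + 2) := by ring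
        _ ≤ _ := Nat.mul_le_mul_left _ (by have : i.val < j.val := hij
                                           omega)
  let e : Fin (2 * h₂ + 2) → Fin M := fun i => ⟨g * (i.val + 1), by have := hgM i; omega⟩
  have he : ∀ i j, i < j → e i < e j := fun i j hij => by
    have := hgij i j hij
    simp only [e, Fin.lt_def]
    omega
  have hF₂ : IsFrame T X t c lam₂ (fun i => V (e i)) := by
    refine ⟨fun i => hVX _, fun i j hij => hVd _ _ (he i j hij), fun i j hij => ?_,
      fun i _ => hVcX _, fun i _ => Or.inl (hVcX _)⟩
    · have := (hVs _ _ (he i j hij)).sparse_subset (k := 1) hlam0.le Subset.rfl Subset.rfl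
        (Or.inl (by simp))
      exact this.mono (by linarith)
  have hnot : ¬ _ := fun htri => hcon₂ (key₂ hX hA hU ht0 hδ0 hδ2 (by nlinarith) hF₂ htri)
  push Not at hnot
  obtain ⟨i, j, k, hij, hjk, S, hS, B, hB, C, hC, hSt, hSc, hBc, hCc, hno⟩ := hnot
  have h1 := hgij i j hij
  have h2 := hgij j k hjk
  have h3 := hgM k
  obtain ⟨f, hf, hfp, hfq, hfr⟩ := exists_increasing_through (M := M) hpq hqr
    (Nat.le_mul_of_pos_right g i.val.succ_pos) h1 h2 (by omega)
  replace hfp : f p = e i := Fin.ext hfp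
  replace hfq : f q = e j := Fin.ext hfq
  replace hfr : f r = e k := Fin.ext hfr
  have hSc' : c₁ * t ≤ S.card := by
    refine le_trans ?_ hSc
    have : (0 : ℝ) < h₂ := by exact_mod_cast hh₂0
    rw [hc₁, div_mul_eq_mul_div]
    gcongr
    linarith
  obtain ⟨W, hWp, hWq, hWr, hF₁⟩ := exists_frame_of_smooth (V := fun x => V (f x)) (S := S)
    (B := B) (C := C) (c := c) (c' := c₁) (mu := lam₁) hpq hqr hp
    (fun x => hVX _) (fun x y hxy => hVd _ _ (hf x y hxy)) hlam0.le hlam1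
    (fun x y hxy => hVs _ _ (hf x y hxy)) (by linarith) (fun x => hVcX _) (by rwa [hfp])
    (by rwa [hfq]) (by rwa [hfr]) hSt hSc' (by rwa [hfq]) (by rwa [hfr])
  refine hcon₁ (key₁ hX hA hU ht0 hδ0 hδ1 (by linarith) hF₁ ?_)
  rw [hWp, hWq, hWr]
  exact fun s hs u hu v hv ⟨a1, a2, a3⟩ => hno s hs u hu v hv a1 a2 a3

theorem isTransOn_union {n : ℕ} {T : Tournament n} {A B : Finset (Fin n)} (hA : T.IsTransOn A)
    (hB : T.IsTransOn B) (h : ∀ a ∈ A, ∀ b ∈ B, T.adj a b) : T.IsTransOn (A ∪ B) := by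
  intro u hu v hv w hw huv hvw
  rw [mem_union] at hu hv hw
  rcases hu with hu | hu <;> rcases hv with hv | hv <;> rcases hw with hw | hw
  · exact hA u hu v hv w hw huv hvw
  · exact h u hu w hw
  · exact absurd hvw (T.asymm _ _ (h w hw v hv))
  · exact h u hu w hw
  · exact absurd huv (T.asymm _ _ (h v hv u hu))
  · exact absurd huv (T.asymm _ _ (h v hv u hu))
  · exact absurd hvw (T.asymm _ _ (h w hw v hv))
  · exact hB u hu v hv w hw huv hvw

theorem isTransOn_singleton {n : ℕ} {T : Tournament n} (x : Fin n) : T.IsTransOn {x} := by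
  intro u hu v hv w hw huv _
  rw [mem_singleton] at hu hv
  subst hu hv
  exact absurd huv (adj_irrefl T _)

theorem exists_trans_of_two_pow_le {n : ℕ} (T : Tournament n) (k : ℕ) {A : Finset (Fin n)}
    (hA : 2 ^ k ≤ A.card) : ∃ S ⊆ A, T.IsTransOn S ∧ k + 1 ≤ S.card := by
  induction k generalizing A with
  | zero =>
    obtain ⟨x, hx⟩ := card_pos.1 (lt_of_lt_of_le (by positivity) hA)
    exact ⟨{x}, by simpa using hx, isTransOn_singleton x, by simp⟩
  | succ k ih =>
    obtain ⟨x, hx⟩ := card_pos.1 (lt_of_lt_of_le (by positivity) hA)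
    have hsplit := card_filter_add_card_filter_not (s := A.erase x) (fun y => T.adj x y)
    rw [card_erase_of_mem hx] at hsplit
    rw [pow_succ] at hA
    rcases le_or_gt (2 ^ k) ((A.erase x).filter (fun y => T.adj x y)).card with h | h
    · obtain ⟨S, hS, hSt, hSc⟩ := ih h
      have hxS : Disjoint {x} S := by
        rw [disjoint_singleton_left]
        intro hxS
        simpa using hS hxS
      refine ⟨{x} ∪ S, union_subset (by simpa using hx)
        (hS.trans ((filter_subset _ _).trans (erase_subset _ _))),
        isTransOn_union (isTransOn_singleton x) hSt ?_, ?_⟩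
      · intro a ha s hs
        rw [mem_singleton.1 ha]
        exact (mem_filter.1 (hS hs)).2
      · rw [card_union_of_disjoint hxS, card_singleton]
        omega
    · have h' : 2 ^ k ≤ ((A.erase x).filter (fun y => ¬ T.adj x y)).card := by omega
      obtain ⟨S, hS, hSt, hSc⟩ := ih h'
      have hxS : Disjoint S {x} := by
        rw [disjoint_singleton_right]
        intro hxS
        simpa using hS hxS
      refine ⟨S ∪ {x}, union_subset
        (hS.trans ((filter_subset _ _).trans (erase_subset _ _))) (by simpa using hx),
        isTransOn_union hSt (isTransOn_singleton x) ?_, ?_⟩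
      · intro s hs a ha
        rw [mem_singleton.1 ha]
        have hs' := mem_filter.1 (hS hs)
        exact adj_of_not_adj (mem_erase.1 hs'.1).1.symm hs'.2
      · rw [card_union_of_disjoint hxS, card_singleton]
        omega

theorem bddAbove_card_trans {n : ℕ} (T : Tournament n) (X : Finset (Fin n)) :
    BddAbove {k | ∃ S, S ⊆ X ∧ T.IsTransOn S ∧ S.card = k} :=
  ⟨X.card, by rintro _ ⟨S, hS, -, rfl⟩; exact card_le_card hS⟩

theorem exists_card_eq_trSizeOn {n : ℕ} (T : Tournament n) (X : Finset (Fin n)) :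
    ∃ S ⊆ X, T.IsTransOn S ∧ S.card = T.trSizeOn X :=
  Nat.sSup_mem (s := {k | ∃ S, S ⊆ X ∧ T.IsTransOn S ∧ S.card = k})
    ⟨0, ∅, empty_subset _, by simp [IsTransOn], rfl⟩ (bddAbove_card_trans T X)

theorem card_le_trSizeOn {n : ℕ} {T : Tournament n} {X S : Finset (Fin n)} (hS : S ⊆ X)
    (hSt : T.IsTransOn S) : S.card ≤ T.trSizeOn X :=
  le_csSup (bddAbove_card_trans T X) ⟨S, hS, hSt, rfl⟩

/-- Positive powers tend to `1` as the exponent tends to `0`. -/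
theorem exists_small_exponent {δ b : ℝ} (hδ : 0 < δ) (hb : 0 < b) :
    ∃ ε : ℝ, 0 < ε ∧ ε ≤ 1 ∧ 1 - δ < δ ^ ε ∧ b ^ ε < 2 := by
  have hcont : ∀ a : ℝ, 0 < a → Filter.Tendsto (fun ε : ℝ => a ^ ε) (nhdsWithin 0 (Set.Ioi 0))
      (nhds 1) := fun a ha => by
    have h : Continuous fun ε : ℝ => a ^ ε := Real.continuous_const_rpow ha.ne'
    simpa using (h.tendsto 0).mono_left nhdsWithin_le_nhds
  have h1 := (hcont δ hδ).eventually_const_lt (show 1 - δ < 1 by linarith)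
  have h2 := (hcont b hb).eventually_lt_const (show (1 : ℝ) < 2 by norm_num)
  have h3 : ∀ᶠ ε : ℝ in nhdsWithin 0 (Set.Ioi 0), ε ∈ Set.Ioc (0 : ℝ) 1 :=
    Ioc_mem_nhdsGT one_pos
  obtain ⟨ε, ⟨h1, h2⟩, h3⟩ := ((h1.and h2).and h3).exists
  exact ⟨ε, h3.1, h3.2, h1, h2⟩

/-- A set `X` is critical if it violates the bound `|X| ^ ε` but no proper subset does. -/
theorem exists_critical {n : ℕ} {T : Tournament n} {ε : ℝ} (h : (T.trSize : ℝ) < (n : ℝ) ^ ε) :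
    ∃ X : Finset (Fin n), (T.trSizeOn X : ℝ) < (X.card : ℝ) ^ ε ∧
      ∀ Y ⊂ X, (Y.card : ℝ) ^ ε ≤ T.trSizeOn Y := by
  let P := (univ : Finset (Finset (Fin n))).filter
    fun X => (T.trSizeOn X : ℝ) < (X.card : ℝ) ^ ε
  have hP : P.Nonempty := ⟨univ, by simpa [P, trSize] using h⟩
  obtain ⟨X, hX, hmin⟩ := exists_min_image P card hP
  refine ⟨X, (mem_filter.1 hX).2, fun Y hY => ?_⟩
  by_contra! hlt
  exact (hmin Y (mem_filter.2 ⟨mem_univ _, hlt⟩)).not_gt (card_lt_card hY)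

variable {n : ℕ} {T : Tournament n} {X : Finset (Fin n)} {ε : ℝ}

theorem ample_of_critical (hε0 : 0 < ε) (hε1 : ε ≤ 1)
    (hX : (T.trSizeOn X : ℝ) < (X.card : ℝ) ^ ε)
    (hY : ∀ Y ⊂ X, (Y.card : ℝ) ^ ε ≤ T.trSizeOn Y) : Ample T X (T.trSizeOn X) := by
  intro A hAX
  obtain ⟨S, hSA, hSt, hSc⟩ := exists_card_eq_trSizeOn T A
  refine ⟨S, hSA, hSt, ?_⟩
  rcases eq_or_ssubset_of_subset hAX with rfl | hlt
  · rw [hSc, mul_comm]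
  rw [hSc]
  refine le_trans ?_ (mul_le_mul_of_nonneg_right (hY A hlt) (Nat.cast_nonneg _))
  refine (mul_le_mul_of_nonneg_left hX.le (Nat.cast_nonneg _)).trans ?_
  rcases A.card.eq_zero_or_pos with h0 | hA0
  · rw [h0]; simp [hε0.ne']
  have hA : (0 : ℝ) < A.card := by exact_mod_cast hA0
  have hle : (A.card : ℝ) ≤ X.card := by exact_mod_cast card_le_card hAX
  have hXc : (0 : ℝ) < X.card := hA.trans_le hle
  have e1 : ∀ a : ℝ, 0 < a → a = a ^ ε * a ^ (1 - ε) := fun a ha => by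
    rw [← Real.rpow_add ha, add_sub_cancel, Real.rpow_one]
  calc (A.card : ℝ) * (X.card : ℝ) ^ ε
      = (A.card : ℝ) ^ ε * (A.card : ℝ) ^ (1 - ε) * (X.card : ℝ) ^ ε := by rw [← e1 _ hA]
    _ ≤ (A.card : ℝ) ^ ε * (X.card : ℝ) ^ (1 - ε) * (X.card : ℝ) ^ ε := by
        refine mul_le_mul_of_nonneg_right (mul_le_mul_of_nonneg_left ?_
          (Real.rpow_nonneg hA.le _)) (Real.rpow_nonneg hXc.le _)
        exact Real.rpow_le_rpow hA.le hle (sub_nonneg.2 hε1)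
    _ = (A.card : ℝ) ^ ε * ((X.card : ℝ) ^ ε * (X.card : ℝ) ^ (1 - ε)) := by ring
    _ = _ := by rw [← e1 _ hXc]

theorem unsplit_of_critical {δ : ℝ} (hε0 : 0 < ε) (hδ0 : 0 < δ) (hδ : 1 - δ < δ ^ ε)
    (ht : 0 < T.trSizeOn X) (hX : (T.trSizeOn X : ℝ) < (X.card : ℝ) ^ ε)
    (hY : ∀ Y ⊂ X, (Y.card : ℝ) ^ ε ≤ T.trSizeOn Y) : Unsplit T X δ (T.trSizeOn X) := by
  intro A hAX S hSX hAc hSt hSc hd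
  have ht' : (0 : ℝ) < T.trSizeOn X := by exact_mod_cast ht
  have hSne : S.Nonempty := by
    rw [← card_pos]
    exact_mod_cast (mul_pos hδ0 ht').trans_le hSc
  have hlt : A ⊂ X := by
    refine hAX.ssubset_of_ne ?_
    rintro rfl
    obtain ⟨s, hs⟩ := hSne
    exact disjoint_left.1 hd (hSX hs) hs
  obtain ⟨R, hRA, hRt, hRc⟩ := exists_card_eq_trSizeOn T A
  have hR : δ ^ ε * (X.card : ℝ) ^ ε ≤ R.card := by
    rw [← Real.mul_rpow hδ0.le (Nat.cast_nonneg _), hRc]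
    exact (Real.rpow_le_rpow (by positivity) hAc hε0.le).trans (hY A hlt)
  have hdR : Disjoint R S := hd.mono_left hRA
  have hbig : T.trSizeOn X < R.card + S.card := by
    have h1 : δ ^ ε * (T.trSizeOn X : ℝ) ≤ δ ^ ε * (X.card : ℝ) ^ ε := by gcongr
    have h2 : (1 - δ) * (T.trSizeOn X : ℝ) < δ ^ ε * T.trSizeOn X := by gcongr
    have h3 : (T.trSizeOn X : ℝ) < R.card + S.card := by linarith
    exact_mod_cast h3
  have hno : ¬ T.IsTransOn (R ∪ S) := fun h => by
    have := card_le_trSizeOn (union_subset (hRA.trans hAX) hSX) h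
    rw [card_union_of_disjoint hdR] at this
    omega
  constructor
  · exact fun h => hno (isTransOn_union hRt hSt fun a ha s hs => h a (hRA ha) s hs)
  · exact fun h => hno (union_comm S R ▸
      isTransOn_union hSt hRt fun s hs a ha => h a (hRA ha) s hs)

theorem two_pow_le_card_of_critical {K : ℕ} (hε0 : 0 < ε) (hK : ((2 : ℝ) ^ K) ^ ε < 2)
    (hX : (T.trSizeOn X : ℝ) < (X.card : ℝ) ^ ε) : 2 ^ K ≤ X.card := by
  by_contra! hlt
  have h1 : (X.card : ℝ) ^ ε ≤ ((2 : ℝ) ^ K) ^ ε :=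
    Real.rpow_le_rpow (by positivity) (by exact_mod_cast hlt.le) hε0.le
  have h2 : T.trSizeOn X < 2 := by exact_mod_cast (hX.trans_le h1).trans hK
  have h3 : X.card < 2 := by
    by_contra! h
    obtain ⟨S, hS, hSt, hSc⟩ := exists_trans_of_two_pow_le T 1 (A := X) (by simpa using h)
    have := card_le_trSizeOn hS hSt
    omega
  interval_cases h : X.card
  · rw [Nat.cast_zero, Real.zero_rpow hε0.ne'] at hX
    exact absurd hX (Nat.cast_nonneg _).not_gt
  · obtain ⟨S, hS, hSt, hSc⟩ := exists_trans_of_two_pow_le T 0 (A := X) (by simp [h])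
    have h4 := card_le_trSizeOn hS hSt
    rw [Nat.cast_one, Real.one_rpow] at hX
    have : T.trSizeOn X < 1 := by exact_mod_cast hX
    omega

end TournamentEH


theorem stmt9 {n₁ n₂ : ℕ} (H₁ : Tournament n₁) (H₂ : Tournament n₂)
    (h₁ : H₁.IsLeftSigmaGalaxy) (h₂ : H₂.IsLeftTriangularGalaxy) : EHPair H₁ H₂ := by
  open TournamentEH in
  obtain ⟨δ, hδ0, N, hN⟩ := exists_unsplit_threshold h₁ h₂
  obtain ⟨ε, hε0, hε1, hδ, hK⟩ := exists_small_exponent hδ0 (show (0 : ℝ) < 2 ^ N by positivity)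
  refine ⟨ε, hε0, fun n T hcon₁ hcon₂ => ?_⟩
  by_contra! hlt
  obtain ⟨X, hX, hY⟩ := exists_critical hlt
  have hc := two_pow_le_card_of_critical hε0 hK hX
  obtain ⟨S, hS, hSt, hSc⟩ := exists_trans_of_two_pow_le T N hc
  have ht := card_le_trSizeOn hS hSt
  rcases hN (Nat.lt_two_pow_self.le.trans hc)
    (by exact_mod_cast (by omega : N ≤ T.trSizeOn X)) (ample_of_critical hε0 hε1 hX hY)
    (unsplit_of_critical hε0 hδ0 hδ (by omega) hX hY) with h | h
  · exact hcon₁ h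
  · exact hcon₂ h
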